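/- arXiv:2106.15521 — 2 statements merged into one kernel-verified Lean document; each statement's English description precedes it below -/
import Mathlib

section
/- Let n be an integer with 1 ≤ n ≤ 200 and let α satisfy 0.0001 < α < 0.1. Let u_0,…,u_n be the mid-p upper endpoints at level 1−α and l_0,…,l_n the mid-p lower endpoints at level 1−α. Then 0 < u_0 < u_1 < ⋯ < u_n = 1 and 0 = l_0 < l_1 < ⋯ < l_n < 1, the inequalities ∫_{u_{i−1}}^{u_i} Σ_{x=i}^n B(n,x,p) dp ≥ (1−α)(u_i − u_{i−1}) hold for every i = 1,…,n, and the inequalities ∫_{l_i}^{l_{i+1}} Σ_{x=0}^i B(n,x,p) dp ≥ (1−α)(l_{i+1} − l_i) hold for every i = 0,…,n−1; that is, the mid-p method gives equal-tail LCC intervals at level 1−2α. -/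
open MeasureTheory

/-- The binomial probability mass function: `B n x p = C(n,x) p^x (1-p)^(n-x)`. -/
noncomputable def B (n x : ℕ) (p : ℝ) : ℝ :=
  (n.choose x : ℝ) * p ^ x * (1 - p) ^ (n - x)

/-- A sequence `0 < u 0 < u 1 < ⋯ < u n = 1` of OLC upper endpoints at level `1 - α`:
each inter-spike average coverage equals the nominal level. -/
def IsOLCUpper (n : ℕ) (α : ℝ) (u : ℕ → ℝ) : Prop :=
  0 < u 0 ∧ (∀ i, i < n → u i < u (i + 1)) ∧ u n = 1 ∧
    ∀ i, 1 ≤ i → i ≤ n →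
      (∫ p in (u (i - 1))..(u i), ∑ x ∈ Finset.Icc i n, B n x p)
        = (1 - α) * (u i - u (i - 1))

/-- A sequence `0 < v 0 < v 1 < ⋯ < v n = 1` giving upper-tail locally correct confidence
(LCC) intervals at level `1 - α`: each inter-spike average coverage is at least the
nominal level. -/
def IsLCCUpper (n : ℕ) (α : ℝ) (v : ℕ → ℝ) : Prop :=
  0 < v 0 ∧ (∀ i, i < n → v i < v (i + 1)) ∧ v n = 1 ∧
    ∀ i, 1 ≤ i → i ≤ n →
      (1 - α) * (v i - v (i - 1))
        ≤ ∫ p in (v (i - 1))..(v i), ∑ x ∈ Finset.Icc i n, B n x p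

/-- A sequence `0 = l 0 < l 1 < ⋯ < l n < 1` of OLC lower endpoints at level `1 - α`. -/
def IsOLCLower (n : ℕ) (α : ℝ) (l : ℕ → ℝ) : Prop :=
  l 0 = 0 ∧ (∀ i, i < n → l i < l (i + 1)) ∧ l n < 1 ∧
    ∀ i, i < n →
      (∫ p in (l i)..(l (i + 1)), ∑ x ∈ Finset.range (i + 1), B n x p)
        = (1 - α) * (l (i + 1) - l i)

/-- A sequence `0 = l 0 < l 1 < ⋯ < l n < 1` giving lower-tail LCC intervals at level
`1 - α`. -/
def IsLCCLower (n : ℕ) (α : ℝ) (l : ℕ → ℝ) : Prop :=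
  l 0 = 0 ∧ (∀ i, i < n → l i < l (i + 1)) ∧ l n < 1 ∧
    ∀ i, i < n →
      (1 - α) * (l (i + 1) - l i)
        ≤ ∫ p in (l i)..(l (i + 1)), ∑ x ∈ Finset.range (i + 1), B n x p

/-- Mid-p upper endpoints at level `1 - α`: `u n = 1` and, for `i < n`,
`u i ∈ (0,1)` solves `P(X < i) + (1/2) P(X = i) = α` at `p = u i`. -/
def IsMidPUpper (n : ℕ) (α : ℝ) (u : ℕ → ℝ) : Prop :=
  u n = 1 ∧ ∀ i, i < n → 0 < u i ∧ u i < 1 ∧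
    (∑ x ∈ Finset.range i, B n x (u i)) + (1 / 2) * B n i (u i) = α

/-- Mid-p lower endpoints at level `1 - α`: `l 0 = 0` and, for `1 ≤ i ≤ n`,
`l i ∈ (0,1)` solves `P(X > i) + (1/2) P(X = i) = α` at `p = l i`. -/
def IsMidPLower (n : ℕ) (α : ℝ) (l : ℕ → ℝ) : Prop :=
  l 0 = 0 ∧ ∀ i, 1 ≤ i → i ≤ n → 0 < l i ∧ l i < 1 ∧
    (∑ x ∈ Finset.Icc (i + 1) n, B n x (l i)) + (1 / 2) * B n i (l i) = α

/-- Logarithm of the ratio of the two boundary terms -/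
noncomputable def logRatio (k N r s y : ℝ) : ℝ :=
  -Real.log (1 - y) - k * (Real.log (1 + y) - Real.log (1 - y))
    + N * (Real.log (1 + r * y) - Real.log (1 - r * y))
    - (Real.log (1 + s * y) - Real.log (1 - s * y))

lemma hasDerivAt_log_one_add_mul {r y : ℝ} (h : 0 < 1 + r * y) :
    HasDerivAt (fun t => Real.log (1 + r * t)) (r / (1 + r * y)) y := by
  have := ((hasDerivAt_id y).const_mul r |>.const_add 1).log h.ne'
  simpa using this

lemma hasDerivAt_log_div_one_sub {r y : ℝ} (h : 0 ≤ r * y) (h' : r * y < 1) :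
    HasDerivAt (fun t => Real.log (1 + r * t) - Real.log (1 - r * t))
      (2 * r / (1 - (r * y) ^ 2)) y := by
  have e1 := hasDerivAt_log_one_add_mul (r := r) (y := y) (by linarith)
  have e2 := hasDerivAt_log_one_add_mul (r := -r) (y := y) (by linarith)
  simp only [neg_mul, ← sub_eq_add_neg] at e2
  refine (e1.sub e2).congr_deriv ?_
  have h3 : 1 - r * y ≠ 0 := by linarith
  have h4 : 1 + r * y ≠ 0 := by linarith
  have g2 : 1 - (r * y) ^ 2 = (1 - r * y) * (1 + r * y) := by ring
  rw [g2, div_sub_div _ _ h4 h3, mul_comm (1 - r * y)]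
  congr 1
  ring

lemma hasDerivAt_logRatio {k N r s y : ℝ} (hy0 : 0 ≤ y) (hy1 : y < 1) (hr0 : 0 ≤ r) (hr1 : r ≤ 1)
    (hs0 : 0 ≤ s) (hs1 : s ≤ 1) :
    HasDerivAt (logRatio k N r s)
      (1 / (1 - y) - 2 * k / (1 - y ^ 2) + 2 * N * r / (1 - (r * y) ^ 2)
        - 2 * s / (1 - (s * y) ^ 2)) y := by
  have e1 := hasDerivAt_log_one_add_mul (r := -1) (y := y) (by linarith)
  have e2 := hasDerivAt_log_div_one_sub (r := 1) (y := y) (by linarith) (by linarith)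
  have e3 := hasDerivAt_log_div_one_sub (r := r) (y := y) (by positivity) (by nlinarith)
  have e4 := hasDerivAt_log_div_one_sub (r := s) (y := y) (by positivity) (by nlinarith)
  simp only [neg_mul, one_mul, ← sub_eq_add_neg] at e1 e2
  refine (((e1.neg.sub (e2.const_mul k)).add (e3.const_mul N)).sub e4).congr_deriv ?_
  ring

lemma logRatio_zero (k N r s : ℝ) : logRatio k N r s 0 = 0 := by simp [logRatio]

/-- The derivative of `logRatio` is bounded below by a polynomial. -/
lemma poly_le_deriv_logRatio {k N r s v L t K₁ K₂ K₃ : ℝ} (ht0 : 0 ≤ t) (ht1 : t < 1)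
    (hr0 : 0 ≤ r) (hr1 : r ≤ 1) (hs0 : 0 ≤ s) (hs1 : s ≤ 1) (hv0 : 0 ≤ v) (hL : 0 ≤ L)
    (hN : N * r = k - L * v) (hk : k * (1 - r) = L * (1 + v) / 2)
    (h1 : 1 ≤ (1 + K₁ * t ^ 2) * ((1 - t ^ 2) * (1 - (r * t) ^ 2)))
    (h2 : 1 ≤ K₂ * (1 - (r * t) ^ 2)) (h3 : 1 ≤ K₃ * (1 - (s * t) ^ 2)) :
    1 + t + t ^ 2 + t ^ 3 + t ^ 4 + t ^ 5 - L * (1 + v) * (1 + r) * (t ^ 2 + K₁ * t ^ 4)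
        - 2 * L * v * (1 + r ^ 2 * t ^ 2 + K₂ * r ^ 4 * t ^ 4) - 2 * s - 2 * s ^ 3 * K₃ * t ^ 2
      ≤ 1 / (1 - t) - 2 * k / (1 - t ^ 2) + 2 * N * r / (1 - (r * t) ^ 2)
        - 2 * s / (1 - (s * t) ^ 2) := by
  have hrt : r * t < 1 := by nlinarith
  have hst : s * t < 1 := by nlinarith
  have hrt0 : 0 ≤ r * t := by positivity
  have hst0 : 0 ≤ s * t := by positivity
  have p1 : 0 < 1 - t ^ 2 := by nlinarith
  have p2 : 0 < 1 - (r * t) ^ 2 := by nlinarith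
  have p3 : 0 < 1 - (s * t) ^ 2 := by nlinarith
  have p4 : 0 < 1 - t := by linarith
  have a1 : 1 / ((1 - t ^ 2) * (1 - (r * t) ^ 2)) ≤ 1 + K₁ * t ^ 2 := by
    rw [div_le_iff₀ (by positivity)]; exact h1
  have a2 : 1 / (1 - (r * t) ^ 2) ≤ 1 + r ^ 2 * t ^ 2 + K₂ * r ^ 4 * t ^ 4 := by
    rw [div_le_iff₀ p2]
    nlinarith [mul_nonneg (sub_nonneg.2 h2) (show 0 ≤ (r * t) ^ 4 by positivity)]
  have a3 : 1 / (1 - (s * t) ^ 2) ≤ 1 + s ^ 2 * K₃ * t ^ 2 := by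
    rw [div_le_iff₀ p3]
    nlinarith [mul_nonneg (sub_nonneg.2 h3) (show 0 ≤ (s * t) ^ 2 by positivity)]
  have a4 : 1 + t + t ^ 2 + t ^ 3 + t ^ 4 + t ^ 5 ≤ 1 / (1 - t) := by
    rw [le_div_iff₀ p4]
    nlinarith [show 0 ≤ t ^ 6 by positivity]
  have hid : 1 / (1 - t) - 2 * k / (1 - t ^ 2) + 2 * N * r / (1 - (r * t) ^ 2)
      = 1 / (1 - t) - L * (1 + v) * (1 + r) * t ^ 2 * (1 / ((1 - t ^ 2) * (1 - (r * t) ^ 2)))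
        - 2 * L * v * (1 / (1 - (r * t) ^ 2)) := by
    have e : 2 * N * r = 2 * k - 2 * (L * v) := by linear_combination 2 * hN
    rw [e]
    have : L * (1 + v) * (1 + r) = 2 * k * (1 - r ^ 2) := by linear_combination -2 * (1 + r) * hk
    rw [this, show 2 * k * (1 - r ^ 2) * t ^ 2 = 2 * k * (t ^ 2 - (r * t) ^ 2) by ring]
    generalize (r * t) ^ 2 = w at p2 ⊢
    have p2' := p2.ne'
    field_simp
    ring
  rw [hid]
  have b1 := mul_le_mul_of_nonneg_left a1 (show 0 ≤ L * (1 + v) * (1 + r) * t ^ 2 by positivity)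
  have b2 := mul_le_mul_of_nonneg_left a2 (show 0 ≤ 2 * L * v by positivity)
  have b3 := mul_le_mul_of_nonneg_left a3 (show 0 ≤ 2 * s by positivity)
  have b4 : 2 * s / (1 - (s * t) ^ 2) = 2 * s * (1 / (1 - (s * t) ^ 2)) := by ring
  rw [b4]
  nlinarith [b1, b2, b3, a4]

lemma poly_le_logRatio {k N r s v L y K₁ K₂ K₃ : ℝ} (hy0 : 0 ≤ y) (hy1 : y < 1)
    (hr0 : 0 ≤ r) (hr1 : r ≤ 1) (hs0 : 0 ≤ s) (hs1 : s ≤ 1) (hv0 : 0 ≤ v) (hL : 0 ≤ L)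
    (hN : N * r = k - L * v) (hk : k * (1 - r) = L * (1 + v) / 2)
    (h1 : ∀ t, 0 ≤ t → t ≤ y → 1 ≤ (1 + K₁ * t ^ 2) * ((1 - t ^ 2) * (1 - (r * t) ^ 2)))
    (h2 : ∀ t, 0 ≤ t → t ≤ y → 1 ≤ K₂ * (1 - (r * t) ^ 2))
    (h3 : ∀ t, 0 ≤ t → t ≤ y → 1 ≤ K₃ * (1 - (s * t) ^ 2)) :
    y + y ^ 2 / 2 + y ^ 3 / 3 + y ^ 4 / 4 + y ^ 5 / 5 + y ^ 6 / 6
        - L * (1 + v) * (1 + r) * (y ^ 3 / 3 + K₁ * y ^ 5 / 5)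
        - 2 * L * v * (y + r ^ 2 * y ^ 3 / 3 + K₂ * r ^ 4 * y ^ 5 / 5) - 2 * s * y
        - 2 * s ^ 3 * K₃ * y ^ 3 / 3
      ≤ logRatio k N r s y := by
  set Q : ℝ → ℝ := fun y => y + y ^ 2 / 2 + y ^ 3 / 3 + y ^ 4 / 4 + y ^ 5 / 5 + y ^ 6 / 6
        - L * (1 + v) * (1 + r) * (y ^ 3 / 3 + K₁ * y ^ 5 / 5)
        - 2 * L * v * (y + r ^ 2 * y ^ 3 / 3 + K₂ * r ^ 4 * y ^ 5 / 5) - 2 * s * y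
        - 2 * s ^ 3 * K₃ * y ^ 3 / 3 with hQ
  have hQd : ∀ t, HasDerivAt Q (1 + t + t ^ 2 + t ^ 3 + t ^ 4 + t ^ 5
      - L * (1 + v) * (1 + r) * (t ^ 2 + K₁ * t ^ 4)
      - 2 * L * v * (1 + r ^ 2 * t ^ 2 + K₂ * r ^ 4 * t ^ 4) - 2 * s - 2 * s ^ 3 * K₃ * t ^ 2) t := by
    intro t
    have p := fun n : ℕ => hasDerivAt_pow n t
    have i := hasDerivAt_id t
    have := (((((((((i.add ((p 2).div_const 2)).add ((p 3).div_const 3)).add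
      ((p 4).div_const 4)).add ((p 5).div_const 5)).add ((p 6).div_const 6)).sub
      ((((p 3).div_const 3).add (((p 5).const_mul K₁).div_const 5)).const_mul
        (L * (1 + v) * (1 + r)))).sub
      (((i.add (((p 3).const_mul (r ^ 2)).div_const 3)).add
        (((p 5).const_mul (K₂ * r ^ 4)).div_const 5)).const_mul (2 * L * v))).sub
      (i.const_mul (2 * s))).sub (((p 3).const_mul (2 * s ^ 3 * K₃)).div_const 3))
    refine (this.congr_deriv ?_).congr_of_eventuallyEq (Filter.Eventually.of_forall fun x => ?_)
    · norm_num; ring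
    · simp [hQ]
  have hmono : MonotoneOn (fun t => logRatio k N r s t - Q t) (Set.Icc 0 y) := by
    have hd : ∀ t ∈ Set.Icc 0 y, HasDerivAt (fun t => logRatio k N r s t - Q t) _ t :=
      fun t ht => (hasDerivAt_logRatio (k := k) (N := N) ht.1 (ht.2.trans_lt hy1) hr0 hr1 hs0
        hs1).sub (hQd t)
    refine monotoneOn_of_deriv_nonneg (convex_Icc _ _)
      (fun t ht => (hd t ht).continuousAt.continuousWithinAt)
      (fun t ht => (hd t (interior_subset ht)).differentiableAt.differentiableWithinAt) ?_
    intro t ht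
    have ht := interior_subset ht
    rw [(hd t ht).deriv]
    have := poly_le_deriv_logRatio ht.1 (ht.2.trans_lt hy1) hr0 hr1 hs0 hs1 hv0 hL hN hk
      (h1 t ht.1 ht.2) (h2 t ht.1 ht.2) (h3 t ht.1 ht.2)
    linarith
  have := hmono (Set.left_mem_Icc.2 hy0) (Set.right_mem_Icc.2 hy0) hy0
  simp only [logRatio_zero] at this
  have hQ0 : Q 0 = 0 := by simp [hQ]
  rw [hQ0] at this
  change Q y ≤ _
  linarith

lemma box_nonneg {a b c d : ℝ} (ha : 0 ≤ a) (hb : 0 ≤ b) (hc : 0 ≤ c) (hd : 0 ≤ d)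
    (i j k l : ℕ) : 0 ≤ a ^ i * b ^ j * c ^ k * d ^ l := by positivity

lemma poly_diag_small {v y : ℝ} (h1 : 0 ≤ v) (h2 : v ≤ 0.26) (h3 : 0 ≤ y) (h4 : y ≤ 1.75 * v ^ 2) :
    0 ≤ 2 * v ^ 3 / 3 + 2 * v ^ 5 / 5
      + (1 + v) * (y ^ 2 / 2 - 2 / 3 * (1 + y / 2 - y ^ 2 / 4) * y ^ 2
        - 0.88 * (1 + y / 2 - y ^ 2 / 4) * y ^ 4)
      + y ^ 3 / 3 + y ^ 4 / 4 - 0.0892 * (1 - v) ^ 3 * y ^ 3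
      - 2 * v * (1 + y / 2 - y ^ 2 / 4) * (y ^ 2 / 3 + 0.214 * y ^ 4) := by
  have h5 : y ≤ 0.119 := by nlinarith
  have h6 : y ^ 2 ≤ (1.75 * v ^ 2) ^ 2 := pow_le_pow_left₀ h3 h4 2
  have h7 : v ^ 3 * v ≤ v ^ 3 * 0.26 := by gcongr
  have B := box_nonneg h1 (sub_nonneg.2 h2) h3 (sub_nonneg.2 h5)
  have h8 : 0 ≤ (1 + v) * (y ^ 2 / 2 - 2 / 3 * (1 + y / 2 - y ^ 2 / 4) * y ^ 2
        - 0.88 * (1 + y / 2 - y ^ 2 / 4) * y ^ 4)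
      + y ^ 3 / 3 + y ^ 4 / 4 - 0.0892 * (1 - v) ^ 3 * y ^ 3
      - 2 * v * (1 + y / 2 - y ^ 2 / 4) * (y ^ 2 / 3 + 0.214 * y ^ 4) + 0.6 * y ^ 2 := by
    linarith [B 0 5 0 6, B 0 5 1 5, B 0 5 2 4, B 0 5 3 3, B 0 5 4 2, B 0 5 5 1, B 0 5 6 0, B 1 4 0
      6, B 1 4 1 5, B 1 4 2 4, B 1 4 3 3, B 1 4 4 2, B 1 4 5 1, B 1 4 6 0, B 2 3 0 6, B 2 3 1 5, B
      2 3 2 4, B 2 3 3 3, B 2 3 4 2, B 2 3 5 1, B 2 3 6 0, B 3 2 0 6, B 3 2 1 5, B 3 2 2 4, B 3 2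
      3 3, B 3 2 4 2, B 3 2 5 1, B 3 2 6 0, B 4 1 0 6, B 4 1 1 5, B 4 1 2 4, B 4 1 3 3, B 4 1 4 2,
      B 4 1 5 1, B 4 1 6 0, B 5 0 0 6, B 5 0 1 5, B 5 0 2 4, B 5 0 3 3, B 5 0 4 2, B 5 0 5 1, B 5
      0 6 0]
  have h9 : 0 ≤ v ^ 5 := by positivity
  have h10 : 0 ≤ v ^ 3 := by positivity
  linarith

lemma poly_diag_left {v y : ℝ} (h1 : 0.26 ≤ v) (h2 : v ≤ 1) (h3 : 0 ≤ y) (h4 : y ≤ 0.155) :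
    0 ≤ 2 * v ^ 3 / 3 + 2 * v ^ 5 / 5
      + (1 + v) * (y ^ 2 / 2 - 2 / 3 * (1 + y / 2 - y ^ 2 / 4) * y ^ 2
        - 0.88 * (1 + y / 2 - y ^ 2 / 4) * y ^ 4)
      + y ^ 3 / 3 + y ^ 4 / 4 - 0.0892 * (1 - v) ^ 3 * y ^ 3
      - 2 * v * (1 + y / 2 - y ^ 2 / 4) * (y ^ 2 / 3 + 0.214 * y ^ 4) := by
  have B := box_nonneg (sub_nonneg.2 h1) (sub_nonneg.2 h2) h3 (sub_nonneg.2 h4)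
  linarith [B 0 5 0 6, B 0 5 1 5, B 0 5 2 4, B 0 5 3 3, B 0 5 4 2, B 0 5 5 1, B 0 5 6 0, B 1 4 0
    6, B 1 4 1 5, B 1 4 2 4, B 1 4 3 3, B 1 4 4 2, B 1 4 5 1, B 1 4 6 0, B 2 3 0 6, B 2 3 1 5, B 2
    3 2 4, B 2 3 3 3, B 2 3 4 2, B 2 3 5 1, B 2 3 6 0, B 3 2 0 6, B 3 2 1 5, B 3 2 2 4, B 3 2 3 3,
    B 3 2 4 2, B 3 2 5 1, B 3 2 6 0, B 4 1 0 6, B 4 1 1 5, B 4 1 2 4, B 4 1 3 3, B 4 1 4 2, B 4 1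
    5 1, B 4 1 6 0, B 5 0 0 6, B 5 0 1 5, B 5 0 2 4, B 5 0 3 3, B 5 0 4 2, B 5 0 5 1, B 5 0 6 0]

lemma poly_diag_right {v y : ℝ} (h1 : 0.294 ≤ v) (h2 : v ≤ 1) (h3 : 0.155 ≤ y) (h4 : y ≤ 0.19) :
    0 ≤ 2 * v ^ 3 / 3 + 2 * v ^ 5 / 5
      + (1 + v) * (y ^ 2 / 2 - 2 / 3 * (1 + y / 2 - y ^ 2 / 4) * y ^ 2
        - 0.88 * (1 + y / 2 - y ^ 2 / 4) * y ^ 4)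
      + y ^ 3 / 3 + y ^ 4 / 4 - 0.0892 * (1 - v) ^ 3 * y ^ 3
      - 2 * v * (1 + y / 2 - y ^ 2 / 4) * (y ^ 2 / 3 + 0.214 * y ^ 4) := by
  have B := box_nonneg (sub_nonneg.2 h1) (sub_nonneg.2 h2) (sub_nonneg.2 h3) (sub_nonneg.2 h4)
  linarith [B 0 5 0 6, B 0 5 1 5, B 0 5 2 4, B 0 5 3 3, B 0 5 4 2, B 0 5 5 1, B 0 5 6 0, B 1 4 0
    6, B 1 4 1 5, B 1 4 2 4, B 1 4 3 3, B 1 4 4 2, B 1 4 5 1, B 1 4 6 0, B 2 3 0 6, B 2 3 1 5, B 2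
    3 2 4, B 2 3 3 3, B 2 3 4 2, B 2 3 5 1, B 2 3 6 0, B 3 2 0 6, B 3 2 1 5, B 3 2 2 4, B 3 2 3 3,
    B 3 2 4 2, B 3 2 5 1, B 3 2 6 0, B 4 1 0 6, B 4 1 1 5, B 4 1 2 4, B 4 1 3 3, B 4 1 4 2, B 4 1
    5 1, B 4 1 6 0, B 5 0 0 6, B 5 0 1 5, B 5 0 2 4, B 5 0 3 3, B 5 0 4 2, B 5 0 5 1, B 5 0 6 0]

lemma poly_cut_left {v y : ℝ} (h1 : 0.3155 ≤ v) (h2 : v ≤ 0.35) (h3 : 0 ≤ y) (h4 : y ≤ 0.25) :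
    0 ≤ 2 * v ^ 3 / 3 + 2 * v ^ 5 / 5
      + (1 + v) * (y ^ 2 / 2 - (1 + y / 2 - y ^ 2 / 4) * y ^ 2 / 3 - y * (1 + y) * (1 - v) / 12
        - 0.44 * (1 + y / 2 - y ^ 2 / 4) * y ^ 4 - 0.11 * y ^ 3 * (1 + y) * (1 - v))
      + y ^ 3 / 3 + y ^ 4 / 4 + y ^ 5 / 5 + y ^ 6 / 6 - 0.0892 * (1 - v) ^ 3 * y ^ 3
      - 0.0429 * v * (1 - v) ^ 2 * (1 + 1.5 * y) := by
  have B := box_nonneg (sub_nonneg.2 h1) (sub_nonneg.2 h2) h3 (sub_nonneg.2 h4)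
  linarith [B 0 5 0 6, B 0 5 1 5, B 0 5 2 4, B 0 5 3 3, B 0 5 4 2, B 0 5 5 1, B 0 5 6 0, B 1 4 0
    6, B 1 4 1 5, B 1 4 2 4, B 1 4 3 3, B 1 4 4 2, B 1 4 5 1, B 1 4 6 0, B 2 3 0 6, B 2 3 1 5, B 2
    3 2 4, B 2 3 3 3, B 2 3 4 2, B 2 3 5 1, B 2 3 6 0, B 3 2 0 6, B 3 2 1 5, B 3 2 2 4, B 3 2 3 3,
    B 3 2 4 2, B 3 2 5 1, B 3 2 6 0, B 4 1 0 6, B 4 1 1 5, B 4 1 2 4, B 4 1 3 3, B 4 1 4 2, B 4 1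
    5 1, B 4 1 6 0, B 5 0 0 6, B 5 0 1 5, B 5 0 2 4, B 5 0 3 3, B 5 0 4 2, B 5 0 5 1, B 5 0 6 0]

lemma poly_cut_mid {v y : ℝ} (h1 : 0.35 ≤ v) (h2 : v ≤ 0.4) (h3 : 0 ≤ y) (h4 : y ≤ 0.37) :
    0 ≤ 2 * v ^ 3 / 3 + 2 * v ^ 5 / 5
      + (1 + v) * (y ^ 2 / 2 - (1 + y / 2 - y ^ 2 / 4) * y ^ 2 / 3 - y * (1 + y) * (1 - v) / 12
        - 0.44 * (1 + y / 2 - y ^ 2 / 4) * y ^ 4 - 0.11 * y ^ 3 * (1 + y) * (1 - v))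
      + y ^ 3 / 3 + y ^ 4 / 4 + y ^ 5 / 5 + y ^ 6 / 6 - 0.0892 * (1 - v) ^ 3 * y ^ 3
      - 0.0429 * v * (1 - v) ^ 2 * (1 + 1.5 * y) := by
  have B := box_nonneg (sub_nonneg.2 h1) (sub_nonneg.2 h2) h3 (sub_nonneg.2 h4)
  linarith [B 0 5 0 6, B 0 5 1 5, B 0 5 2 4, B 0 5 3 3, B 0 5 4 2, B 0 5 5 1, B 0 5 6 0, B 1 4 0
    6, B 1 4 1 5, B 1 4 2 4, B 1 4 3 3, B 1 4 4 2, B 1 4 5 1, B 1 4 6 0, B 2 3 0 6, B 2 3 1 5, B 2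
    3 2 4, B 2 3 3 3, B 2 3 4 2, B 2 3 5 1, B 2 3 6 0, B 3 2 0 6, B 3 2 1 5, B 3 2 2 4, B 3 2 3 3,
    B 3 2 4 2, B 3 2 5 1, B 3 2 6 0, B 4 1 0 6, B 4 1 1 5, B 4 1 2 4, B 4 1 3 3, B 4 1 4 2, B 4 1
    5 1, B 4 1 6 0, B 5 0 0 6, B 5 0 1 5, B 5 0 2 4, B 5 0 3 3, B 5 0 4 2, B 5 0 5 1, B 5 0 6 0]

lemma poly_cut_right {v y : ℝ} (h1 : 0.4 ≤ v) (h2 : v ≤ 1) (h3 : 0 ≤ y) (h4 : y ≤ 0.606) :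
    0 ≤ 2 * v ^ 3 / 3 + 2 * v ^ 5 / 5
      + (1 + v) * (y ^ 2 / 2 - (1 + y / 2 - y ^ 2 / 4) * y ^ 2 / 3 - y * (1 + y) * (1 - v) / 12
        - 0.44 * (1 + y / 2 - y ^ 2 / 4) * y ^ 4 - 0.11 * y ^ 3 * (1 + y) * (1 - v))
      + y ^ 3 / 3 + y ^ 4 / 4 + y ^ 5 / 5 + y ^ 6 / 6 - 0.0892 * (1 - v) ^ 3 * y ^ 3
      - 0.0429 * v * (1 - v) ^ 2 * (1 + 1.5 * y) := by
  have B := box_nonneg (sub_nonneg.2 h1) (sub_nonneg.2 h2) h3 (sub_nonneg.2 h4)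
  linarith [B 0 5 0 6, B 0 5 1 5, B 0 5 2 4, B 0 5 3 3, B 0 5 4 2, B 0 5 5 1, B 0 5 6 0, B 1 4 0
    6, B 1 4 1 5, B 1 4 2 4, B 1 4 3 3, B 1 4 4 2, B 1 4 5 1, B 1 4 6 0, B 2 3 0 6, B 2 3 1 5, B 2
    3 2 4, B 2 3 3 3, B 2 3 4 2, B 2 3 5 1, B 2 3 6 0, B 3 2 0 6, B 3 2 1 5, B 3 2 2 4, B 3 2 3 3,
    B 3 2 4 2, B 3 2 5 1, B 3 2 6 0, B 4 1 0 6, B 4 1 1 5, B 4 1 2 4, B 4 1 3 3, B 4 1 4 2, B 4 1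
    5 1, B 4 1 6 0, B 5 0 0 6, B 5 0 1 5, B 5 0 2 4, B 5 0 3 3, B 5 0 4 2, B 5 0 5 1, B 5 0 6 0]

lemma poly_skew_small {v y : ℝ} (h1 : 0 ≤ v) (h2 : v ≤ 0.62) (h3 : 0 ≤ y) (h4 : y ≤ 1.73 * v ^ 2) :
    0 ≤ 2 * v ^ 3 / 3 + 2 * v ^ 5 / 5 + y ^ 2 / 2 + y ^ 3 / 3 + y ^ 4 / 4 + y ^ 5 / 5
      - 0.0892 * (1 - v) ^ 3 * y ^ 3
      - (1 + y / 2) * (1 + v) * (1 + (1 - v) / 2) * (y ^ 2 / 3 + 0.39 * y ^ 4)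
      - 2 * v * (1 + y / 2) * ((1 - v) ^ 2 * y ^ 2 / 12 + 0.014 * (1 - v) ^ 4 * y ^ 4) := by
  rcases h1.eq_or_lt with rfl | hv
  · have : y = 0 := by linarith
    simp [this]
  obtain ⟨z, hz0, hz1, rfl⟩ : ∃ z, 0 ≤ z ∧ z ≤ 1 ∧ y = 1.73 * v ^ 2 * z := by
    refine ⟨y / (1.73 * v ^ 2), by positivity, (div_le_one (by positivity)).2 h4, ?_⟩
    field_simp
  have B := box_nonneg h1 (sub_nonneg.2 h2) hz0 (sub_nonneg.2 hz1)
  have B' := fun i j k l => mul_nonneg (pow_nonneg h1 3) (B i j k l)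
  linear_combination 488281250000000000000/2362988351365649283 * B' 0 12 0 5 +
    2441406250000000000000/2362988351365649283 * B' 0 12 1 4 +
    4882812500000000000000/2362988351365649283 * B' 0 12 2 3 +
    4882812500000000000000/2362988351365649283 * B' 0 12 3 2 +
    2441406250000000000000/2362988351365649283 * B' 0 12 4 1 +
    488281250000000000000/2362988351365649283 * B' 0 12 5 0 +
    1953125000000000000000/787662783788549761 * B' 1 11 0 5 +
    9765625000000000000000/787662783788549761 * B' 1 11 1 4 +
    19531250000000000000000/787662783788549761 * B' 1 11 2 3 +
    19531250000000000000000/787662783788549761 * B' 1 11 3 2 +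
    9765625000000000000000/787662783788549761 * B' 1 11 4 1 +
    1953125000000000000000/787662783788549761 * B' 1 11 5 0 +
    10779726562500000000000/787662783788549761 * B' 2 10 0 5 +
    53898632812500000000000/787662783788549761 * B' 2 10 1 4 +
    107656827299804687500000/787662783788549761 * B' 2 10 2 3 +
    107375950649414062500000/787662783788549761 * B' 2 10 3 2 +
    53477317836914062500000/787662783788549761 * B' 2 10 4 1 +
    10639288237304687500000/787662783788549761 * B' 2 10 5 0 +
    108548046875000000000000/2362988351365649283 * B' 3 9 0 5 +
    542740234375000000000000/2362988351365649283 * B' 3 9 1 4 +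
    1081528534279003906250000/2362988351365649283 * B' 3 9 2 3 +
    357873121005005346875000/787662783788549761 * B' 3 9 3 2 +
    176957942106006787500000/787662783788549761 * B' 3 9 4 1 +
    34863603360669409375000/787662783788549761 * B' 3 9 5 0 +
    82255664062500000000000/787662783788549761 * B' 4 8 0 5 +
    411278320312500000000000/787662783788549761 * B' 4 8 1 4 +
    2451007701045197265625000/2362988351365649283 * B' 4 8 2 3 +
    805881800268847551687500/787662783788549761 * B' 4 8 3 2 +
    394590860429997837750000/787662783788549761 * B' 4 8 4 1 +
    230066912778648123812500/2362988351365649283 * B' 4 8 5 0 +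
    133410937500000000000000/787662783788549761 * B' 5 7 0 5 +
    667054687500000000000000/787662783788549761 * B' 5 7 1 4 +
    3960742202247125000000000/2362988351365649283 * B' 5 7 2 3 +
    1292484085687700287328750/787662783788549761 * B' 5 7 3 2 +
    10005166645963389542771875/12602604540616796176 * B' 5 7 4 1 +
    5733239060834554836535625/37807813621850388528 * B' 5 7 5 0 +
    158273828125000000000000/787662783788549761 * B' 6 6 0 5 +
    791369140625000000000000/787662783788549761 * B' 6 6 1 4 +
    4680169217023726562500000/2362988351365649283 * B' 6 6 2 3 +
    4543867174680796315629925/2362988351365649283 * B' 6 6 3 2 +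
    2167983756738497971952165/2362988351365649283 * B' 6 6 4 1 +
    404999861581428218822240/2362988351365649283 * B' 6 6 5 0 +
    138366093750000000000000/787662783788549761 * B' 7 5 0 5 +
    691830468750000000000000/787662783788549761 * B' 7 5 1 4 +
    4074701432981632812500000/2362988351365649283 * B' 7 5 2 3 +
    1307300681997019535606100/787662783788549761 * B' 7 5 3 2 +
    196382082364442721151378257/252052090812335923520 * B' 7 5 4 1 +
    4268176792956639808694350987/30246250897480310822400 * B' 7 5 5 0 +
    88449609375000000000000/787662783788549761 * B' 8 4 0 5 +
    442248046875000000000000/787662783788549761 * B' 8 4 1 4 +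
    2594146347815371093750000/2362988351365649283 * B' 8 4 2 3 +
    825096564585018119512125/787662783788549761 * B' 8 4 3 2 +
    3038185742690112630172767821/6301302270308398088000 * B' 8 4 4 1 +
    78617736386090983291945829581/945195340546259713200000 * B' 8 4 5 0 +
    120935937500000000000000/2362988351365649283 * B' 9 3 0 5 +
    604679687500000000000000/2362988351365649283 * B' 9 3 1 4 +
    1177720530294718750000000/2362988351365649283 * B' 9 3 2 3 +
    1114360997211131280042250/2362988351365649283 * B' 9 3 3 2 +
    50005992274625145451677310487/236298835136564928300000 * B' 9 3 4 1 +
    4219861115757144068243119206321/126026045406167961760000000 * B' 9 3 5 0 +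
    12431445312500000000000/787662783788549761 * B' 10 2 0 5 +
    62157226562500000000000/787662783788549761 * B' 10 2 1 4 +
    361876369946968750000000/2362988351365649283 * B' 10 2 2 3 +
    113239400137770602534625/787662783788549761 * B' 10 2 3 2 +
    490835734425515450308781373813/7876627837885497610000000 * B' 10 2 4 1 +
    78455268503269837968325755036589/9451953405462597132000000000 * B' 10 2 5 0 +
    2328515625000000000000/787662783788549761 * B' 11 1 0 5 +
    11642578125000000000000/787662783788549761 * B' 11 1 1 4 +
    67561380620269531250000/2362988351365649283 * B' 11 1 2 3 +
    20989720566948261628600/787662783788549761 * B' 11 1 3 2 +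
    21648743156414227706791255669/1969156959471374402500000 * B' 11 1 4 1 +
    229454699925760556570633761294097/236298835136564928300000000000 * B' 11 1 5 0 +
    600898437500000000000/2362988351365649283 * B' 12 0 0 5 +
    3004492187500000000000/2362988351365649283 * B' 12 0 1 4 +
    1931633397357421875000/787662783788549761 * B' 12 0 2 3 +
    5366440877204250024925/2362988351365649283 * B' 12 0 3 2 +
    20598125110743962192329885289/23629883513656492830000000 * B' 12 0 4 1 +
    71450957767335959394973032202117/11814941756828246415000000000000 * B' 12 0 5 0

lemma poly_skew_right {v y : ℝ} (h1 : 0.62 ≤ v) (h2 : v ≤ 1) (h3 : 0 ≤ y) (h4 : y ≤ 0.667) :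
    0 ≤ 2 * v ^ 3 / 3 + 2 * v ^ 5 / 5 + y ^ 2 / 2 + y ^ 3 / 3 + y ^ 4 / 4 + y ^ 5 / 5
      - 0.0892 * (1 - v) ^ 3 * y ^ 3
      - (1 + y / 2) * (1 + v) * (1 + (1 - v) / 2) * (y ^ 2 / 3 + 0.39 * y ^ 4)
      - 2 * v * (1 + y / 2) * ((1 - v) ^ 2 * y ^ 2 / 12 + 0.014 * (1 - v) ^ 4 * y ^ 4) := by
  have B := box_nonneg (sub_nonneg.2 h1) (sub_nonneg.2 h2) h3 (sub_nonneg.2 h4)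
  linarith [B 0 5 0 5, B 0 5 1 4, B 0 5 2 3, B 0 5 3 2, B 0 5 4 1, B 0 5 5 0, B 1 4 0 5, B 1 4 1
    4, B 1 4 2 3, B 1 4 3 2, B 1 4 4 1, B 1 4 5 0, B 2 3 0 5, B 2 3 1 4, B 2 3 2 3, B 2 3 3 2, B 2
    3 4 1, B 2 3 5 0, B 3 2 0 5, B 3 2 1 4, B 3 2 2 3, B 3 2 3 2, B 3 2 4 1, B 3 2 5 0, B 4 1 0 5,
    B 4 1 1 4, B 4 1 2 3, B 4 1 3 2, B 4 1 4 1, B 4 1 5 0, B 5 0 0 5, B 5 0 1 4, B 5 0 2 3, B 5 0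
    3 2, B 5 0 4 1, B 5 0 5 0]

set_option maxHeartbeats 1000000 in
/-- The polynomial lower bound in the regime `i ≤ k`. -/
lemma poly_nonneg_of_le {v y R E : ℝ} (hv0 : 0 ≤ v) (hv1 : v ≤ 1) (hy : 0 ≤ y)
    (hE : E = 1 + y / 2 - y ^ 2 / 4) (hyE : 2 * y ≤ E)
    (hthr : 0.85 * (1 - v) * y ≤ v ^ 2 * E) (hR : 0 ≤ R) (hRy : R ≤ y)
    (hRE : 4 * R ≤ (1 - v) * E) :
    0 ≤ 2 * v * (1 - E) + 2 * v ^ 3 / 3 + 2 * v ^ 5 / 5 + v * y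
      + y ^ 2 / 2 + y ^ 3 / 3 + y ^ 4 / 4 + y ^ 5 / 5 + y ^ 6 / 6
      - 2 / 3 * ((1 - v) / 2) ^ 3 * 1.07 * y ^ 3 - E * (1 + v) * (y ^ 2 + y * R) / 3
      - E * (1 + v) * 2.2 * (y ^ 4 + y ^ 3 * R) / 5
      - 2 * v * E * (R ^ 2 / 3 + 1.07 * R ^ 4 / 5) := by
  have hy1 : y ≤ 0.606 := by nlinarith
  have hE1 : 1 ≤ E := by nlinarith
  have hEv : 0 ≤ E * (1 + v) := by positivity
  have hvE : 0 ≤ v * E := by positivity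
  have hw3 : 0 ≤ (1 - v) ^ 3 * y ^ 3 := by
    have : 0 ≤ 1 - v := by linarith
    positivity
  have hy5 : 0 ≤ y ^ 5 := by positivity
  have hy6 : 0 ≤ y ^ 6 := by positivity
  have e0 : 2 * v * (1 - E) + v * y = v * y ^ 2 / 2 := by rw [hE]; ring
  rcases le_total y 0.19 with h19 | h19
  · have a1 : E * (1 + v) * (y * R) ≤ E * (1 + v) * y ^ 2 := by
      rw [pow_two]; gcongr
    have a2 : E * (1 + v) * (y ^ 3 * R) ≤ E * (1 + v) * y ^ 4 := by
      rw [pow_succ y 3]; gcongr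
    have a3 : v * E * R ^ 2 ≤ v * E * y ^ 2 := by gcongr
    have a4 : v * E * R ^ 4 ≤ v * E * y ^ 4 := by gcongr
    suffices 0 ≤ 2 * v ^ 3 / 3 + 2 * v ^ 5 / 5
      + (1 + v) * (y ^ 2 / 2 - 2 / 3 * (1 + y / 2 - y ^ 2 / 4) * y ^ 2
        - 0.88 * (1 + y / 2 - y ^ 2 / 4) * y ^ 4)
      + y ^ 3 / 3 + y ^ 4 / 4 - 0.0892 * (1 - v) ^ 3 * y ^ 3
      - 2 * v * (1 + y / 2 - y ^ 2 / 4) * (y ^ 2 / 3 + 0.214 * y ^ 4) by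
      rw [← hE] at this
      linarith
    rcases le_total v 0.26 with h26 | h26
    · refine poly_diag_small hv0 h26 hy ?_
      have : E ≤ 1 + y / 2 := by nlinarith
      have h2 : 0.629 * y ≤ v ^ 2 * (1 + y / 2) := by nlinarith [sq_nonneg v]
      nlinarith
    · rcases le_total y 0.155 with h155 | h155
      · exact poly_diag_left h26 hv1 hy h155
      · refine poly_diag_right ?_ hv1 h155 h19
        by_contra! h
        have b1 : v ^ 2 ≤ 0.294 ^ 2 := by gcongr
        have b2 : v ^ 2 * E ≤ 0.294 ^ 2 * E := by gcongr
        nlinarith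
  · have hv : 0.3155 ≤ v := by
      by_contra! h
      have b1 : v ^ 2 ≤ 0.3155 ^ 2 := by gcongr
      have b2 : v ^ 2 * E ≤ 0.3155 ^ 2 * E := by gcongr
      nlinarith
    have hEE : E ^ 2 ≤ 1 + y := by
      have := mul_nonneg (pow_nonneg hy 2) (show 0 ≤ 1 / 4 + y / 4 * (1 - y / 4) by
        have : 0 ≤ 1 - y / 4 := by linarith
        positivity)
      rw [hE]; linarith
    have hE121 : E ≤ 1.2112 := by rw [hE]; nlinarith
    have hEEE : E ^ 3 ≤ 1 + 1.5 * y := by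
      have hz : (y / 2 - y ^ 2 / 4) ^ 3 ≤ (y / 2) ^ 3 := by
        have : 0 ≤ y / 2 - y ^ 2 / 4 := by linarith [mul_nonneg hy (show 0 ≤ 2 - y by linarith)]
        gcongr
        linarith [sq_nonneg y]
      have := mul_nonneg (pow_nonneg hy 3) (show 0 ≤ 0.625 - 3 / 16 * y by linarith)
      rw [hE]; linarith
    have hw : 0 ≤ 1 - v := by linarith
    have a1 : E * R ≤ (1 - v) * (1 + y) / 4 := by
      have h1 := mul_le_mul_of_nonneg_left hRE (zero_le_one.trans hE1)
      have h2 := mul_le_mul_of_nonneg_left hEE hw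
      linarith
    have a2 : E * R ^ 2 ≤ (1 - v) ^ 2 * (1 + 1.5 * y) / 16 := by
      have : E * (4 * R) ^ 2 ≤ E * ((1 - v) * E) ^ 2 := by gcongr
      have h2 : (1 - v) ^ 2 * E ^ 3 ≤ (1 - v) ^ 2 * (1 + 1.5 * y) := by gcongr
      linarith
    have hR2 : R ≤ 0.2073 := by nlinarith
    have a3 : E * R ^ 4 ≤ E * R ^ 2 * 0.2073 ^ 2 := by
      have : R ^ 2 ≤ 0.2073 ^ 2 := by gcongr
      calc E * R ^ 4 = E * R ^ 2 * R ^ 2 := by ring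
        _ ≤ _ := by gcongr
    have b1 := mul_le_mul_of_nonneg_left a1 (show 0 ≤ (1 + v) * y by positivity)
    have b2 := mul_le_mul_of_nonneg_left a1 (show 0 ≤ (1 + v) * y ^ 3 by positivity)
    have b3 : v * (E * R ^ 2 / 3 + 1.07 * (E * R ^ 4) / 5)
        ≤ v * (0.3426 * ((1 - v) ^ 2 * (1 + 1.5 * y) / 16)) := by
      apply mul_le_mul_of_nonneg_left _ hv0
      have : 0 ≤ E * R ^ 2 := by positivity
      linarith
    have b4 : 0 ≤ v * (1 - v) ^ 2 * (1 + 1.5 * y) := by positivity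
    suffices 0 ≤ 2 * v ^ 3 / 3 + 2 * v ^ 5 / 5
      + (1 + v) * (y ^ 2 / 2 - (1 + y / 2 - y ^ 2 / 4) * y ^ 2 / 3 - y * (1 + y) * (1 - v) / 12
        - 0.44 * (1 + y / 2 - y ^ 2 / 4) * y ^ 4 - 0.11 * y ^ 3 * (1 + y) * (1 - v))
      + y ^ 3 / 3 + y ^ 4 / 4 + y ^ 5 / 5 + y ^ 6 / 6 - 0.0892 * (1 - v) ^ 3 * y ^ 3
      - 0.0429 * v * (1 - v) ^ 2 * (1 + 1.5 * y) by
      rw [← hE] at this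
      linarith
    rcases le_total v 0.35 with h35 | h35
    · refine poly_cut_left hv h35 hy ?_
      have b1 : v ^ 2 ≤ 0.35 ^ 2 := by gcongr
      have b2 : v ^ 2 * E ≤ 0.35 ^ 2 * E := by gcongr
      linarith [mul_nonneg (sub_nonneg.2 h35) hy, sq_nonneg y]
    rcases le_total v 0.4 with h40 | h40
    · refine poly_cut_mid h35 h40 hy ?_
      have b1 : v ^ 2 ≤ 0.4 ^ 2 := by gcongr
      have b2 : v ^ 2 * E ≤ 0.4 ^ 2 * E := by gcongr
      by_contra! h
      linarith [mul_nonneg (sub_nonneg.2 h40) hy, mul_nonneg (sub_nonneg.2 h.le) hy]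
    · exact poly_cut_right h40 hv1 hy hy1

/-- The polynomial lower bound in the regime `k < i`. -/
lemma poly_nonneg_of_lt {v y R E : ℝ} (hv0 : 0 ≤ v) (hv1 : v ≤ 1) (hy : 0 ≤ y)
    (hE : E = 1 + y / 2) (hyE : 2 * y ≤ E)
    (hthr : (0.85 * (2 + y) + 4.8 * y) * (2 * y * (1 - v)) ≤ v ^ 2 * (2 + y) ^ 2) (hR : 0 ≤ R)
    (hRy : R ≤ (1 - v) * y / 2) :
    0 ≤ 2 * v * (1 - E) + 2 * v ^ 3 / 3 + 2 * v ^ 5 / 5 + v * y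
      + y ^ 2 / 2 + y ^ 3 / 3 + y ^ 4 / 4 + y ^ 5 / 5 + y ^ 6 / 6
      - 2 / 3 * ((1 - v) / 2) ^ 3 * 1.07 * y ^ 3 - E * (1 + v) * (y ^ 2 + y * R) / 3
      - E * (1 + v) * 1.95 * (y ^ 4 + y ^ 3 * R) / 5
      - 2 * v * E * (R ^ 2 / 3 + 1.07 * R ^ 4 / 5) := by
  have hE1 : 1 ≤ E := by linarith
  have hEv : 0 ≤ E * (1 + v) := by positivity
  have hvE : 0 ≤ v * E := by positivity
  have hw : 0 ≤ 1 - v := by linarith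
  have hw3 : 0 ≤ (1 - v) ^ 3 * y ^ 3 := by positivity
  have hy6 : 0 ≤ y ^ 6 := by positivity
  have e0 : 2 * v * (1 - E) + v * y = 0 := by rw [hE]; ring
  have a1 : E * (1 + v) * (y * R) ≤ E * (1 + v) * (y * ((1 - v) * y / 2)) := by gcongr
  have a2 : E * (1 + v) * (y ^ 3 * R) ≤ E * (1 + v) * (y ^ 3 * ((1 - v) * y / 2)) := by gcongr
  have a3 : v * E * R ^ 2 ≤ v * E * ((1 - v) * y / 2) ^ 2 := by gcongr
  have a4 : v * E * R ^ 4 ≤ v * E * ((1 - v) * y / 2) ^ 4 := by gcongr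
  have a5 : 0 ≤ v * E * ((1 - v) ^ 4 * y ^ 4) := by positivity
  suffices 0 ≤ 2 * v ^ 3 / 3 + 2 * v ^ 5 / 5 + y ^ 2 / 2 + y ^ 3 / 3 + y ^ 4 / 4 + y ^ 5 / 5
      - 0.0892 * (1 - v) ^ 3 * y ^ 3
      - (1 + y / 2) * (1 + v) * (1 + (1 - v) / 2) * (y ^ 2 / 3 + 0.39 * y ^ 4)
      - 2 * v * (1 + y / 2) * ((1 - v) ^ 2 * y ^ 2 / 12 + 0.014 * (1 - v) ^ 4 * y ^ 4) by
    rw [← hE] at this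
    linarith
  rcases le_total v 0.62 with h62 | h62
  · refine poly_skew_small hv0 h62 hy ?_
    by_contra! h
    have hv : 0 < y := lt_of_le_of_lt (by positivity) h
    set z := 1.73 * v ^ 2 with hz
    have hz0 : 0 ≤ z := by positivity
    -- the threshold is monotone in `y`
    have h1 : (0.85 * (2 + z) + 4.8 * z) * (2 * z * (1 - v)) ≤ v ^ 2 * (2 + z) ^ 2 := by
      have h2 : (0.85 * (2 + y) + 4.8 * y) * (2 * y * (1 - v)) * (2 + z) ^ 2
          ≤ v ^ 2 * (2 + z) ^ 2 * (2 + y) ^ 2 := by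
        linarith [mul_le_mul_of_nonneg_right hthr (sq_nonneg (2 + z))]
      have h3 : (0.85 * (2 + z) + 4.8 * z) * (2 + y) ≤ (0.85 * (2 + y) + 4.8 * y) * (2 + z) := by
        linarith
      have h4 : 2 * z * (1 - v) * (2 + y) ≤ 2 * y * (1 - v) * (2 + z) := by
        linarith [mul_nonneg hw (sub_nonneg.2 h.le)]
      have h5 := mul_le_mul h3 h4 (by positivity) (by positivity)
      refine le_of_mul_le_mul_right ?_ (show 0 < (2 + y) ^ 2 by positivity)
      linarith
    rcases hv0.eq_or_lt with rfl | hv0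
    · norm_num at hthr
      nlinarith [mul_pos hv hv]
    have h6 : v ^ 2 * ((0.85 * (2 + z) + 4.8 * z) * (3.46 * (1 - v))) ≤ v ^ 2 * (2 + z) ^ 2 := by
      refine le_trans (le_of_eq ?_) h1
      rw [hz]; ring
    have h7 := le_of_mul_le_mul_left h6 (by positivity)
    rw [hz] at h7
    have B := box_nonneg hv0.le (sub_nonneg.2 h62) (zero_le_one (α := ℝ)) (zero_le_one (α := ℝ))
    linarith [B 4 0 0 0, B 3 1 0 0, B 2 2 0 0, B 1 3 0 0, B 0 4 0 0]
  · refine poly_skew_right h62 hv1 hy (by linarith)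

lemma two_mul_add_le_log {v : ℝ} (h0 : 0 ≤ v) (h1 : v < 1) :
    2 * v + 2 * v ^ 3 / 3 + 2 * v ^ 5 / 5 ≤ Real.log ((1 + v) / (1 - v)) := by
  have h := Real.hasSum_log_sub_log_of_abs_lt_one (abs_lt.2 ⟨by linarith, h1⟩)
  have := sum_le_hasSum (Finset.range 3) (fun j _ => by positivity) h
  rw [Real.log_div (by linarith) (by linarith)]
  refine le_trans (le_of_eq ?_) this
  norm_num [Finset.sum_range_succ]
  ring

lemma log_add_logRatio_nonneg {k N r s v L y E K : ℝ} (hy0 : 0 ≤ y) (hy1 : y < 1)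
    (hr0 : 0 ≤ r) (hr1 : r ≤ 1) (hs : s = (1 - v) / 2) (hv0 : 0 ≤ v) (hv1 : v < 1) (hL : 0 ≤ L)
    (hK : 0 ≤ K) (hN : N * r = k - L * v) (hk : k * (1 - r) = L * (1 + v) / 2) (hLE : L * y ≤ E)
    (h1 : ∀ t, 0 ≤ t → t ≤ y → 1 ≤ (1 + K * t ^ 2) * ((1 - t ^ 2) * (1 - (r * t) ^ 2)))
    (h2 : r * y ≤ 0.255) (h3 : s * y ≤ 0.255)
    (hP : 0 ≤ 2 * v * (1 - E) + 2 * v ^ 3 / 3 + 2 * v ^ 5 / 5 + v * y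
      + y ^ 2 / 2 + y ^ 3 / 3 + y ^ 4 / 4 + y ^ 5 / 5 + y ^ 6 / 6
      - 2 / 3 * ((1 - v) / 2) ^ 3 * 1.07 * y ^ 3 - E * (1 + v) * (y ^ 2 + y * (r * y)) / 3
      - E * (1 + v) * K * (y ^ 4 + y ^ 3 * (r * y)) / 5
      - 2 * v * E * ((r * y) ^ 2 / 3 + 1.07 * (r * y) ^ 4 / 5)) :
    0 ≤ Real.log ((1 + v) / (1 - v)) + logRatio k N r s y := by
  have hs0 : 0 ≤ s := by linarith
  have aux : ∀ {c : ℝ}, 0 ≤ c → c * y ≤ 0.255 → ∀ t, 0 ≤ t → t ≤ y →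
      1 ≤ 1.07 * (1 - (c * t) ^ 2) := by
    intro c hc hcy t ht0 hty
    have : c * t ≤ 0.255 := (mul_le_mul_of_nonneg_left hty hc).trans hcy
    have : (c * t) ^ 2 ≤ 0.255 ^ 2 := by gcongr
    linarith
  have h := poly_le_logRatio hy0 hy1 hr0 hr1 hs0 (by linarith) hv0 hL hN hk h1
    (aux hr0 h2) (aux hs0 h3)
  have hlog := two_mul_add_le_log hv0 hv1
  have hd : 0 ≤ (E - L * y) * ((1 + v) * ((y ^ 2 + y * (r * y)) / 3
      + K * (y ^ 4 + y ^ 3 * (r * y)) / 5)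
      + 2 * v * (1 + (r * y) ^ 2 / 3 + 1.07 * (r * y) ^ 4 / 5)) :=
    mul_nonneg (sub_nonneg.2 hLE) (by positivity)
  rw [hs] at h ⊢
  linarith

lemma log_add_logRatio_nonneg_of_le {k N r s v L y E : ℝ} (hy0 : 0 ≤ y) (hy1 : y < 1)
    (hr0 : 0 ≤ r) (hr1 : r ≤ 1) (hs : s = (1 - v) / 2) (hv0 : 0 ≤ v) (hv1 : v < 1) (hL : 0 ≤ L)
    (hN : N * r = k - L * v) (hk : k * (1 - r) = L * (1 + v) / 2) (hLE : L * y ≤ E)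
    (hE : E = 1 + y / 2 - y ^ 2 / 4) (hyE : 2 * y ≤ E)
    (hthr : 0.85 * (1 - v) * y ≤ v ^ 2 * E) (hrE : 4 * (r * y) ≤ (1 - v) * E) :
    0 ≤ Real.log ((1 + v) / (1 - v)) + logRatio k N r s y := by
  have hy : y ≤ 0.606 := by nlinarith
  have hRy : r * y ≤ y := mul_le_of_le_one_left hy0 hr1
  have hE1 : E ≤ 1.2112 := by nlinarith
  have hE0 : 0 ≤ E := by linarith
  have hvE : v ^ 2 * E ≤ v ^ 2 * 1.2112 := by gcongr
  refine log_add_logRatio_nonneg (K := 2.2) hy0 hy1 hr0 hr1 hs hv0 hv1 hL (by norm_num) hN hk hLE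
    ?_ ?_ ?_ (poly_nonneg_of_le hv0 hv1.le hy0 hE hyE hthr (by positivity) hRy hrE)
  · intro t ht0 hty
    have hw : t ^ 2 ≤ y ^ 2 := by gcongr
    have hw0 : 0 ≤ t ^ 2 := by positivity
    rw [mul_pow]
    set w := t ^ 2
    clear_value w
    have hy2 : y ^ 2 ≤ 0.606 ^ 2 := by gcongr
    have key : r ^ 2 * (1 + 1.2 * w - 2.2 * w ^ 2) ≤ 1.2 - 2.2 * w := by
      have b0 : 1 + 1.2 * w - 2.2 * w ^ 2 ≤ 1.164 := by linarith [mul_self_nonneg (w - 3 / 11)]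
      have b00 : 0 ≤ 1 + 1.2 * w - 2.2 * w ^ 2 := by
        linarith [mul_nonneg hw0 (show 0 ≤ 0.606 ^ 2 - w by linarith)]
      rcases le_total y 0.247 with h | h
      · have b1 : y ^ 2 ≤ 0.247 ^ 2 := by gcongr
        have b2 : r ^ 2 ≤ 1 := pow_le_one₀ hr0 hr1
        have b3 : r ^ 2 * (1 + 1.2 * w - 2.2 * w ^ 2) ≤ 1 * (1 + 1.2 * w - 2.2 * w ^ 2) := by
          gcongr
        linarith [mul_self_nonneg (w - 0.061)]
      rcases le_total y 0.45 with h' | h'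
      · have b1 : y ^ 2 ≤ 0.45 ^ 2 := by gcongr
        have b4 : 0.35 ≤ v := by
          by_contra! hv
          have c1 : v ^ 2 ≤ 0.35 ^ 2 := by gcongr
          have c2 : v ^ 2 * E ≤ 0.35 ^ 2 * E := by gcongr
          have c3 : 0.85 * 0.65 * y ≤ 0.85 * (1 - v) * y := by gcongr; linarith
          linarith [mul_self_nonneg (y - 0.247)]
        have b5 : r ≤ 0.74 := by
          by_contra! hr
          have c1 : 0.74 * y ≤ r * y := by gcongr
          have c2 : (1 - v) * E ≤ 0.65 * E := by gcongr; linarith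
          linarith [mul_self_nonneg (y - 0.247)]
        have b2 : r ^ 2 ≤ 0.74 ^ 2 := by gcongr
        have b3 : r ^ 2 * (1 + 1.2 * w - 2.2 * w ^ 2) ≤ 0.74 ^ 2 * 1.164 := by gcongr
        linarith
      · have b4 : 0.43 ≤ v := by
          by_contra! hv
          have c1 : v ^ 2 ≤ 0.43 ^ 2 := by gcongr
          have c2 : v ^ 2 * E ≤ 0.43 ^ 2 * E := by gcongr
          have c3 : 0.85 * 0.57 * y ≤ 0.85 * (1 - v) * y := by gcongr; linarith
          linarith [mul_self_nonneg (y - 0.45)]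
        have b5 : r ≤ 0.5 := by
          by_contra! hr
          have c1 : 0.5 * y ≤ r * y := by gcongr
          have c2 : (1 - v) * E ≤ 0.57 * E := by gcongr; linarith
          linarith [mul_self_nonneg y]
        have b2 : r ^ 2 ≤ 0.5 ^ 2 := by gcongr
        have b3 : r ^ 2 * (1 + 1.2 * w - 2.2 * w ^ 2) ≤ 0.5 ^ 2 * 1.164 := by gcongr
        linarith
    linarith [mul_nonneg hw0 (sub_nonneg.2 key)]
  · rcases le_total v 0.2 with h | h
    · have : v ^ 2 ≤ 0.2 ^ 2 := by gcongr
      have c3 : 0.85 * 0.8 * y ≤ 0.85 * (1 - v) * y := by gcongr; linarith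
      linarith
    · have : (1 - v) * E ≤ 0.8 * E := by gcongr; linarith
      linarith
  · rw [hs]
    rcases le_total v 0.47 with h | h
    · have : v ^ 2 ≤ 0.47 ^ 2 := by gcongr
      linarith
    · have : (1 - v) * y ≤ 0.53 * y := by gcongr; linarith
      linarith

lemma log_add_logRatio_nonneg_of_lt {k N r s v L y E : ℝ} (hy0 : 0 ≤ y) (hy1 : y < 1)
    (hr0 : 0 ≤ r) (hrs : r ≤ s) (hs : s = (1 - v) / 2) (hv0 : 0 ≤ v) (hv1 : v < 1) (hL : 0 ≤ L)
    (hN : N * r = k - L * v) (hk : k * (1 - r) = L * (1 + v) / 2) (hLE : L * y ≤ E)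
    (hE : E = 1 + y / 2) (hyE : 2 * y ≤ E)
    (hthr : (0.85 * (2 + y) + 4.8 * y) * (2 * y * (1 - v)) ≤ v ^ 2 * (2 + y) ^ 2) :
    0 ≤ Real.log ((1 + v) / (1 - v)) + logRatio k N r s y := by
  have hy : y ≤ 2 / 3 := by linarith
  have hRs : r * y ≤ s * y := by gcongr
  have hv : 0.5 ≤ y → 0.56 ≤ v := by
    intro h
    by_contra! hv
    have c1 : v ^ 2 ≤ 0.56 ^ 2 := by gcongr
    have c2 : v ^ 2 * (2 + y) ^ 2 ≤ 0.56 ^ 2 * (2 + y) ^ 2 := by gcongr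
    have c3 : (0.85 * (2 + y) + 4.8 * y) * (2 * y * 0.44)
      ≤ (0.85 * (2 + y) + 4.8 * y) * (2 * y * (1 - v)) := by gcongr; linarith
    nlinarith
  have hsy : s * y ≤ 0.255 := by
    rcases le_total y 0.5 with h | h
    · nlinarith
    · nlinarith [hv h]
  refine log_add_logRatio_nonneg (K := 1.95) hy0 hy1 hr0 (by linarith) hs hv0 hv1 hL (by norm_num)
    hN hk hLE ?_ (hRs.trans hsy) hsy (poly_nonneg_of_lt hv0 hv1.le hy0 hE hyE hthr (by positivity)
      (by rw [hs] at hRs; linarith))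
  intro t ht0 hty
  have hw : t ^ 2 ≤ y ^ 2 := by gcongr
  have hw0 : 0 ≤ t ^ 2 := by positivity
  rw [mul_pow]
  set w := t ^ 2
  clear_value w
  have hy2 : y ^ 2 ≤ (2 / 3) ^ 2 := by gcongr
  have key : r ^ 2 * (1 + 0.95 * w - 1.95 * w ^ 2) ≤ 0.95 - 1.95 * w := by
    have b0 : 1 + 0.95 * w - 1.95 * w ^ 2 ≤ 1.12 := by linarith [mul_self_nonneg (w - 0.2436)]
    have b00 : 0 ≤ 1 + 0.95 * w - 1.95 * w ^ 2 := by
      linarith [mul_nonneg hw0 (show 0 ≤ (2 / 3) ^ 2 - w by linarith)]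
    rcases le_total y 0.5 with h | h
    · have b1 : y ^ 2 ≤ 0.5 ^ 2 := by gcongr
      have b5 : r ≤ 0.5 := by linarith
      have b2 : r ^ 2 ≤ 0.5 ^ 2 := by gcongr
      have b3 : r ^ 2 * (1 + 0.95 * w - 1.95 * w ^ 2) ≤ 0.5 ^ 2 * 1.12 := by gcongr
      linarith
    · have b5 : r ≤ 0.22 := by linarith [hv h]
      have b2 : r ^ 2 ≤ 0.22 ^ 2 := by gcongr
      have b3 : r ^ 2 * (1 + 0.95 * w - 1.95 * w ^ 2) ≤ 0.22 ^ 2 * 1.12 := by gcongr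
      linarith
  linarith [mul_nonneg hw0 (sub_nonneg.2 key)]

lemma le_mul_of_mul_le_of_le {G l e y : ℝ} (hy0 : 0 ≤ y) (hy1 : y < 1) (hG : 2 ≤ G)
    (hle : l ≤ e) (he : e ≤ 1 / 2) (h : l * (4 + 2 * y - y ^ 2) ≤ 4 * y) :
    (1 - y) * ((G + y) * (G - y))
      ≤ (1 + y) * ((G * (1 - l) + (1 - e) * y) * (G * (1 - l) - (1 - e) * y)) := by
  have hD : 0 < 4 + 2 * y - y ^ 2 := by nlinarith
  have h1 : (1 - e) ^ 2 ≤ (1 - l) ^ 2 := by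
    have : 1 - e ≤ 1 - l := by linarith
    have : 0 ≤ 1 - e := by linarith
    gcongr
  have h2 : 1 - y ≤ (1 + y) * (1 - l) ^ 2 := by
    have h3 : 4 - 2 * y - y ^ 2 ≤ (1 - l) * (4 + 2 * y - y ^ 2) := by linarith
    have h4 : 0 ≤ 4 - 2 * y - y ^ 2 := by nlinarith
    have h5 : (4 - 2 * y - y ^ 2) ^ 2 ≤ ((1 - l) * (4 + 2 * y - y ^ 2)) ^ 2 := by gcongr
    have h6 : (1 + y) * (4 - 2 * y - y ^ 2) ^ 2
      ≤ (1 + y) * ((1 - l) * (4 + 2 * y - y ^ 2)) ^ 2 := by gcongr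
    have h7 : 0 ≤ 2 * y ^ 5 := by positivity
    refine le_of_mul_le_mul_right ?_ (show 0 < (4 + 2 * y - y ^ 2) ^ 2 by positivity)
    linarith
  have h8 : 0 ≤ (G + y) * (G - y) := mul_nonneg (by linarith) (by linarith)
  have h9 := mul_le_mul_of_nonneg_right h2 h8
  have h10 : 0 ≤ (1 + y) * y ^ 2 * ((1 - l) ^ 2 - (1 - e) ^ 2) :=
    mul_nonneg (by positivity) (by linarith)
  linarith

lemma le_mul_of_mul_le_of_sq_le {G l e y : ℝ} (hy0 : 0 ≤ y) (hy1 : y < 1)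
    (hl0 : 0 ≤ l) (hl : l ≤ 1 / 2) (he0 : 0 ≤ e) (he : e ≤ 1 / 2) (hG : 4 ≤ G * (2 - l))
    (h : l * (2 + y) ≤ 2 * y) :
    (1 - y) * ((G + y) * (G - y))
      ≤ (1 + y) * ((G * (1 - l) + (1 - e) * y) * (G * (1 - l) - (1 - e) * y)) := by
  have hl2 : 0 < 2 - l := by linarith
  have hG2 : 2 ≤ G := by
    by_contra! hh
    have := mul_lt_mul_of_pos_right hh hl2
    linarith
  obtain ⟨z, hz⟩ : ∃ z, z = 2 * l / (2 - l) := ⟨_, rfl⟩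
  have hz' : z * (2 - l) = 2 * l := by rw [hz]; field_simp
  have hz0 : 0 ≤ z := by rw [hz]; positivity
  have hz1 : z < 1 := by rw [hz, div_lt_one hl2]; linarith
  have hzy : z ≤ y := by rw [hz, div_le_iff₀ hl2]; linarith
  obtain ⟨g, hg⟩ : ∃ g : ℝ → ℝ, ∀ t, g t =
    G ^ 2 * ((1 + (1 - l) ^ 2) * t - (1 - (1 - l) ^ 2)) - 2 * t ^ 3 := ⟨_, fun _ => rfl⟩
  have g1 : 0 ≤ g 1 := by
    have : 1 ≤ G * (1 - l) := by nlinarith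
    have : 1 ^ 2 ≤ (G * (1 - l)) ^ 2 := by gcongr
    rw [hg]
    linarith
  have gz : 0 ≤ g z := by
    have h16 : 4 ^ 2 ≤ (G * (2 - l)) ^ 2 := by gcongr
    have e1 : g z * (2 - l) ^ 3 = l ^ 3 * ((G * (2 - l)) ^ 2 - 4 ^ 2) := by
      rw [hg, hz]
      field_simp
      ring
    have e2 : 0 ≤ g z * (2 - l) ^ 3 := by
      rw [e1]
      exact mul_nonneg (by positivity) (by linarith)
    exact nonneg_of_mul_nonneg_left e2 (by positivity)
  have gy : 0 ≤ g y := by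
    have e1 : (1 - z) * g y = (1 - y) * g z + (y - z) * g 1
        + 2 * ((y - z) * (1 - y) * (1 - z) * (1 + y + z)) := by
      simp only [hg]
      ring
    have hyz : 0 ≤ y - z := by linarith
    have hy1' : 0 ≤ 1 - y := by linarith
    have hz1' : 0 < 1 - z := by linarith
    exact nonneg_of_mul_nonneg_right (e1 ▸ by positivity) hz1'
  rw [hg] at gy
  have h1 : (1 - e) ^ 2 ≤ 1 := pow_le_one₀ (by linarith) (by linarith)
  have h2 : 0 ≤ (1 + y) * y ^ 2 * (1 - (1 - e) ^ 2) := mul_nonneg (by positivity) (by linarith)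
  linarith

/-- The threshold on the harmonic mean `H` of the two scaled odds. -/
def Threshold (i k H : ℝ) : Prop :=
  1 ≤ H ∧ (i ≤ k → 1.7 * (k + i * H) ≤ i * k * (H - 1) ^ 2) ∧
    (k < i → (1.7 * k + 4.8) * (k + i * H) ≤ i * k ^ 2 * (H - 1) ^ 2)

set_option maxHeartbeats 800000 in
lemma log_add_logRatio_nonneg_of_threshold {i k H y : ℝ} (hi : 2 ≤ i) (hk : 2 ≤ k)
    (hH : Threshold i k H) (hy0 : 0 ≤ y) (hy1 : y < 1)
    (hD : (1 + y) * (((1 + H) * (1 - (k + i * H) / (i * k * (1 + H))) + (1 - 1 / i) * y)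
      * ((1 + H) * (1 - (k + i * H) / (i * k * (1 + H))) - (1 - 1 / i) * y))
      < (1 - y) * ((1 + H + y) * (1 + H - y))) :
    0 ≤ Real.log H + logRatio k (i + k) (k / (k + i * H)) (1 / (1 + H)) y := by
  obtain ⟨hH1, hle, hlt⟩ := hH
  have hiH : 0 < k + i * H := by positivity
  obtain ⟨l, hl⟩ : ∃ l, l = (k + i * H) / (i * k * (1 + H)) := ⟨_, rfl⟩
  obtain ⟨v, hv⟩ : ∃ v, v = (H - 1) / (H + 1) := ⟨_, rfl⟩
  obtain ⟨r, hr⟩ : ∃ r, r = k / (k + i * H) := ⟨_, rfl⟩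
  have hl0 : 0 < l := by rw [hl]; positivity
  have hv0 : 0 ≤ v := by rw [hv]; exact div_nonneg (by linarith) (by linarith)
  have hv1 : v < 1 := by rw [hv, div_lt_one (by linarith)]; linarith
  have hr0 : 0 < r := by rw [hr]; positivity
  have hr1 : r ≤ 1 := by rw [hr, div_le_one hiH]; nlinarith
  have hs : 1 / (1 + H) = (1 - v) / 2 := by rw [hv]; field_simp; ring
  have hHv : (1 + v) / (1 - v) = H := by
    have : 1 - v ≠ 0 := by linarith
    rw [div_eq_iff this, hv]; field_simp; ring
  have hN : (i + k) * r = k - 1 / l * v := by rw [hr, hl, hv]; field_simp; ring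
  have hkr : k * (1 - r) = 1 / l * (1 + v) / 2 := by rw [hr, hl, hv]; field_simp; ring
  have hl2 : l ≤ 1 / 2 := by
    rw [hl, div_le_iff₀ (by positivity)]
    nlinarith [mul_nonneg (sub_nonneg.2 hi) (sub_nonneg.2 hk), mul_nonneg (mul_nonneg (sub_nonneg.2 hi) (sub_nonneg.2 hk)) (sub_nonneg.2 hH1)]
  have he : 1 / i ≤ 1 / 2 := by gcongr
  have he0 : 0 ≤ 1 / i := by positivity
  have hvH : v ^ 2 * (2 * (1 + H)) = (1 - v) * (H - 1) ^ 2 := by rw [hv]; field_simp; ring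
  have hlH : l * (1 + H) * (i * k) = k + i * H := by rw [hl]; field_simp
  have hL : ∀ {E}, y ≤ E * l → 1 / l * y ≤ E := by
    intro E hE
    rw [one_div_mul_eq_div, div_le_iff₀ hl0]
    exact hE
  rw [← hl] at hD
  rw [← hr, hs, ← hHv]
  rcases le_or_gt i k with h | h
  · obtain ⟨E, hE⟩ : ∃ E, E = 1 + y / 2 - y ^ 2 / 4 := ⟨_, rfl⟩
    have hE0 : 0 ≤ E := by nlinarith
    have hyE : y ≤ E * l := by
      by_contra! hlt'
      refine hD.not_ge (le_mul_of_mul_le_of_le hy0 hy1 (by linarith) ?_ he ?_)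
      · rw [hl, div_le_div_iff₀ (by positivity) (by positivity)]
        nlinarith [mul_le_mul_of_nonneg_left h (show 0 ≤ i * H by positivity)]
      · rw [hE] at hlt'
        linarith
    have hthr : 0.85 * (1 - v) * l ≤ v ^ 2 := by
      have h1 : 1.7 * (l * (1 + H)) ≤ (H - 1) ^ 2 := by
        refine le_of_mul_le_mul_right ?_ (show 0 < i * k by positivity)
        linarith [hle h]
      have h2 := mul_le_mul_of_nonneg_left h1 (sub_nonneg.2 hv1.le)
      refine le_of_mul_le_mul_right ?_ (show 0 < 2 * (1 + H) by positivity)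
      linarith
    have hLy := hL hyE
    refine log_add_logRatio_nonneg_of_le hy0 hy1 hr0.le hr1 rfl hv0 hv1 (by positivity) hN hkr hLy
      hE ?_ ?_ ?_
    · linarith [mul_le_mul_of_nonneg_left hl2 hE0]
    · have h1 := mul_le_mul_of_nonneg_left hyE (show 0 ≤ 0.85 * (1 - v) by linarith)
      have h2 := mul_le_mul_of_nonneg_right hthr hE0
      linarith
    · have h1 : 4 * r ≤ (1 - v) * (1 / l) := by
        have h3 : r = 1 / i * ((1 - v) * (1 / l)) / 2 := by rw [hr, hl, hv]; field_simp; ring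
        have h4 : 0 ≤ (1 - v) * (1 / l) := mul_nonneg (by linarith) (by positivity)
        have := mul_le_mul_of_nonneg_right he h4
        linarith
      have h2 := mul_le_mul_of_nonneg_right h1 hy0
      have h5 := mul_le_mul_of_nonneg_left hLy (sub_nonneg.2 hv1.le)
      linarith
  · obtain ⟨E, hE⟩ : ∃ E, E = 1 + y / 2 := ⟨_, rfl⟩
    have hE0 : 0 ≤ E := by linarith
    have hlk : l * k ≤ 1 := by
      rw [hl, div_mul_eq_mul_div, div_le_one (by positivity)]
      nlinarith
    have h1 : (1.7 + 4.8 * l) * (l * (1 + H)) ≤ (H - 1) ^ 2 := by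
      refine le_of_mul_le_mul_right ?_ (show 0 < i * k ^ 2 by positivity)
      have h2 : (1.7 * k + 4.8 * (l * k)) * (k + i * H) ≤ (1.7 * k + 4.8 * 1) * (k + i * H) := by
        gcongr
      rw [← hlH] at h2 hlt
      linarith [hlt h]
    have hyE : y ≤ E * l := by
      by_contra! hlt'
      refine hD.not_ge (le_mul_of_mul_le_of_sq_le hy0 hy1 hl0.le hl2 he0 he ?_ ?_)
      · have h3 : 4 / 3 * l ≤ H - 1 := by
          refine (pow_le_pow_iff_left₀ (by positivity) (by linarith) two_ne_zero).1 ?_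
          have : (1.7 + 4.8 * l) * (l * 2) ≤ (1.7 + 4.8 * l) * (l * (1 + H)) := by
            gcongr
            linarith
          have : 0 ≤ l ^ 2 := by positivity
          linarith
        linarith [mul_le_mul_of_nonneg_right h3 (show 0 ≤ 2 - l by linarith),
          mul_nonneg hl0.le (sub_nonneg.2 hl2)]
      · rw [hE] at hlt'
        linarith
    have hthr : (0.85 + 2.4 * l) * l * (1 - v) ≤ v ^ 2 := by
      have h2 := mul_le_mul_of_nonneg_left h1 (sub_nonneg.2 hv1.le)
      refine le_of_mul_le_mul_right ?_ (show 0 < 2 * (1 + H) by positivity)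
      linarith
    refine log_add_logRatio_nonneg_of_lt hy0 hy1 hr0.le ?_ rfl hv0 hv1 (by positivity) hN hkr
      (hL hyE) hE ?_ ?_
    · rw [hr, ← hs, div_le_div_iff₀ (by positivity) (by positivity)]
      linarith [mul_le_mul_of_nonneg_right h.le (show 0 ≤ H by linarith)]
    · linarith [mul_le_mul_of_nonneg_left hl2 hE0]
    · have h2 : 2 * y ≤ (2 + y) * l := by rw [hE] at hyE; linarith
      have h3 : (0.85 * (2 + y) + 2.4 * (2 * y)) * (2 * y * (1 - v))
          ≤ (0.85 * (2 + y) + 2.4 * ((2 + y) * l)) * ((2 + y) * l * (1 - v)) := by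
        have : 0 ≤ 1 - v := by linarith
        gcongr
      have h4 := mul_le_mul_of_nonneg_right hthr (sq_nonneg (2 + y))
      linarith

lemma log_div_gap_nonneg {i k H y : ℝ} (hi : 2 ≤ i) (hk : 2 ≤ k)
    (hH : Threshold i k H) (hy0 : 0 ≤ y) (hy1 : y < 1)
    (hD : H / (1 - y) * (((i - 1) * k + (k - 1) * i * (H / (1 - y))) *
        ((i - 1) * k + (k - 1) * i * (H / (1 + y))))
      < H / (1 + y) * ((i * k) ^ 2 * ((1 + H / (1 + y)) * (1 + H / (1 - y))))) :
    0 ≤ i * Real.log (H / (1 - y)) - (i - 1) * Real.log (H / (1 + y))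
      - (i + k) * (Real.log (k + i * (H / (1 - y))) - Real.log (k + i * (H / (1 + y))))
      + Real.log (1 + H / (1 - y)) - Real.log (1 + H / (1 + y)) := by
  have hH1 : 1 ≤ H := hH.1
  have hy2 : 0 < 1 - y := by linarith
  have hiH : 0 < k + i * H := by positivity
  have hr : k / (k + i * H) ≤ 1 := by
    rw [div_le_one hiH]
    have : 0 ≤ i * H := by positivity
    linarith
  have hr0 : 0 < k / (k + i * H) := by positivity
  have hs : 1 / (1 + H) ≤ 1 := by
    rw [div_le_one (by positivity)]
    linarith
  have hs0 : 0 < 1 / (1 + H) := by positivity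
  have hry : 0 < 1 - k / (k + i * H) * y := by nlinarith
  have hsy : 0 < 1 - 1 / (1 + H) * y := by nlinarith
  have h := log_add_logRatio_nonneg_of_threshold hi hk hH hy0 hy1 ?_
  · rw [logRatio] at h
    have e1 : k + i * (H / (1 - y))
        = (k + i * H) * (1 - k / (k + i * H) * y) / (1 - y) := by field_simp; ring
    have e2 : k + i * (H / (1 + y))
        = (k + i * H) * (1 + k / (k + i * H) * y) / (1 + y) := by field_simp; ring
    have e3 : 1 + H / (1 - y) = (1 + H) * (1 - 1 / (1 + H) * y) / (1 - y) := by field_simp; ring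
    have e4 : 1 + H / (1 + y) = (1 + H) * (1 + 1 / (1 + H) * y) / (1 + y) := by field_simp; ring
    rw [e1, e2, e3, e4]
    repeat rw [Real.log_div (by positivity) (by positivity)]
    repeat rw [Real.log_mul (by positivity) (by positivity)]
    linarith
  · have hc : 0 < H / ((1 - y) * (1 + y)) * (i * k) ^ 2 := by positivity
    refine lt_of_mul_lt_mul_left ?_ hc.le
    have hw : 0 < (1 - y) * (1 + y) := by positivity
    refine lt_of_eq_of_lt ?_ ((mul_lt_mul_of_pos_right hD hw).trans_eq ?_)
    · field_simp
      ring
    · field_simp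
      ring

lemma pow_mul_le_pow_mul_of_threshold (I K : ℕ) (hI : 1 ≤ I) (hK : 1 ≤ K) {X Y : ℝ} (hX : 0 < X)
    (hXY : X ≤ Y) (hH : Threshold (I + 1) (K + 1) (2 * X * Y / (X + Y)))
    (hD : Y * ((I * (K + 1) + K * (I + 1) * Y) * (I * (K + 1) + K * (I + 1) * X))
      < X * (((I + 1) * (K + 1)) ^ 2 * ((1 + X) * (1 + Y)))) :
    X ^ I * (1 + X) * ((K + 1) + (I + 1) * Y) ^ (I + K + 2)
      ≤ Y ^ (I + 1) * (1 + Y) * ((K + 1) + (I + 1) * X) ^ (I + K + 2) := by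
  have hY : 0 < Y := hX.trans_le hXY
  obtain ⟨H, hH'⟩ : ∃ H, H = 2 * X * Y / (X + Y) := ⟨_, rfl⟩
  obtain ⟨y, hy⟩ : ∃ y, y = (Y - X) / (Y + X) := ⟨_, rfl⟩
  have hy0 : 0 ≤ y := by rw [hy]; exact div_nonneg (by linarith) (by linarith)
  have hy1 : y < 1 := by rw [hy, div_lt_one (by linarith)]; linarith
  have eX : H / (1 + y) = X := by
    rw [div_eq_iff (by linarith), hH', hy]
    field_simp
    ring
  have eY : H / (1 - y) = Y := by
    rw [div_eq_iff (by linarith), hH', hy]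
    field_simp
    ring
  rw [← hH'] at hH
  have hI' : (1 : ℝ) ≤ I := by exact_mod_cast hI
  have hK' : (1 : ℝ) ≤ K := by exact_mod_cast hK
  have h := log_div_gap_nonneg (i := I + 1) (k := K + 1) (by linarith) (by linarith) hH hy0 hy1
    (by rw [eX, eY]; simpa only [add_sub_cancel_right] using hD)
  rw [eX, eY] at h
  rw [← Real.log_le_log_iff (by positivity) (by positivity)]
  repeat rw [Real.log_mul (by positivity) (by positivity)]
  repeat rw [Real.log_pow]
  push_cast
  linarith

lemma pow_mul_le_pow_mul_of_lt (I K : ℕ) (hI : 1 ≤ I) (hK : 1 ≤ K) {a b : ℝ} (ha : 0 < a)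
    (hab : a ≤ b) (hb : b < 1) (hH : Threshold (I + 1) (K + 1)
      (2 * ((K + 1) * a * b) / ((I + 1) * (a * (1 - b) + b * (1 - a)))))
    (hD : b - b * (1 - b) / ((I + 1) * (1 - b) + K * b)
      < a + a * (1 - a) / (I * (1 - a) + (K + 1) * a)) :
    (I + 1) * (((I + 1) * (1 - a) + (K + 1) * a) * (a ^ I * (1 - a) ^ (K + 1)))
      ≤ (K + 1) * (((I + 1) * (1 - b) + (K + 1) * b) * (b ^ (I + 1) * (1 - b) ^ K)) := by
  have hI' : (1 : ℝ) ≤ I := by exact_mod_cast hI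
  have hK' : (1 : ℝ) ≤ K := by exact_mod_cast hK
  have ha1 : 0 < 1 - a := by linarith
  have hb1 : 0 < 1 - b := by linarith
  have hb0 : 0 < b := by linarith
  obtain ⟨X, hX⟩ : ∃ X, X = (K + 1) / (I + 1) * (a / (1 - a)) := ⟨_, rfl⟩
  obtain ⟨Y, hY⟩ : ∃ Y, Y = (K + 1) / (I + 1) * (b / (1 - b)) := ⟨_, rfl⟩
  have hX0 : 0 < X := by rw [hX]; positivity
  have hY0 : 0 < Y := by rw [hY]; positivity
  have eX : (K + 1) + (I + 1) * X = (K + 1) / (1 - a) := by rw [hX]; field_simp; ring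
  have eY : (K + 1) + (I + 1) * Y = (K + 1) / (1 - b) := by rw [hY]; field_simp; ring
  have hXY : X ≤ Y := by rw [hX, hY]; gcongr
  have h := pow_mul_le_pow_mul_of_threshold I K hI hK hX0 hXY ?_ ?_
  · rw [eX, eY, hX, hY] at h
    have e : ∀ c : ℝ, 0 < 1 - c → (1 + (K + 1) / (I + 1) * (c / (1 - c))
      = ((I + 1) * (1 - c) + (K + 1) * c) / ((I + 1) * (1 - c))) := by
      intro c hc
      field_simp
    rw [e a ha1, e b hb1] at h
    have hc : 0 < ((I : ℝ) + 1) ^ (I + 2) * ((1 - a) * (1 - b)) ^ (I + K + 2)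
      / ((K + 1) ^ I * (K + 1) ^ (I + K + 2)) := by positivity
    have h2 := mul_le_mul_of_nonneg_left h hc.le
    refine le_of_eq_of_le ?_ (h2.trans_eq ?_)
    · simp only [mul_pow, div_pow]
      field_simp
      ring
    · simp only [mul_pow, div_pow]
      field_simp
      ring
  · convert hH using 1
    rw [hX, hY]
    field_simp
  · have hDa : 0 < I * (1 - a) + (K + 1) * a := by positivity
    have hDb : 0 < (I + 1) * (1 - b) + K * b := by positivity
    have h1 : b * (1 - a) * ((I * (1 - b) + K * b) * (I * (1 - a) + K * a))
      < a * (1 - b) * (((I + 1) * (1 - a) + (K + 1) * a) * ((I + 1) * (1 - b) + (K + 1) * b)) := by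
      have h2 := mul_lt_mul_of_pos_right hD (mul_pos hDa hDb)
      have e1 : (b - b * (1 - b) / ((I + 1) * (1 - b) + K * b)) * ((I * (1 - a) + (K + 1) * a) * ((I + 1) * (1 - b) + K * b)) = b * (I * (1 - b) + K * b) * (I * (1 - a) + (K + 1) * a) := by
        field_simp
        ring
      have e2 : (a + a * (1 - a) / (I * (1 - a) + (K + 1) * a)) * ((I * (1 - a) + (K + 1) * a) * ((I + 1) * (1 - b) + K * b)) = a * ((I + 1) * (1 - a) + (K + 1) * a) * ((I + 1) * (1 - b) + K * b) := by
        field_simp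
        ring
      rw [e1, e2] at h2
      linarith
    have hc : 0 < ((K : ℝ) + 1) ^ 3 / (I + 1) / ((1 - a) * (1 - b)) ^ 2 := by positivity
    refine lt_of_eq_of_lt ?_ ((mul_lt_mul_of_pos_left h1 hc).trans_eq ?_)
    · rw [hX, hY]
      field_simp
    · rw [hX, hY]
      field_simp

lemma B_succ_mul (n x : ℕ) (hx : x < n) (p : ℝ) :
    B n (x + 1) p * ((x + 1) * (1 - p)) = B n x p * ((n - x) * p) := by
  have h := Nat.choose_succ_right_eq n x
  have h' : (n.choose (x + 1) : ℝ) * (x + 1) = n.choose x * (n - x) := by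
    rw [← Nat.cast_sub hx.le]
    exact_mod_cast h
  obtain ⟨m, rfl⟩ := Nat.exists_eq_add_of_lt hx
  simp only [B, show x + m + 1 - (x + 1) = m by omega, show x + m + 1 - x = m + 1 by omega]
  linear_combination p ^ (x + 1) * (1 - p) ^ (m + 1) * h'

lemma B_nonneg (n x : ℕ) {p : ℝ} (h0 : 0 ≤ p) (h1 : p ≤ 1) : 0 ≤ B n x p := by
  have : 0 ≤ 1 - p := by linarith
  unfold B
  positivity

/-- The mid-p lower tail `P(X < m) + P(X = m) / 2` of a binomial variable. -/
noncomputable def midTail (n m : ℕ) (p : ℝ) : ℝ :=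
  ∑ x ∈ Finset.range m, B n x p + 1 / 2 * B n m p

namespace TailCheck

open Nat (add sub mul div pow ble)

/-- Rounded-down sum of `2 ^ 40 * B n y (A / (A + A'))` over `y < x`, where `t` is a lower bound
for the term at `x`; the summation stops at terms below `2 ^ 26`. -/
def tailSum (A A' n : ℕ) (x : ℕ) : ℕ → ℕ :=
  Nat.rec (motive := fun _ => ℕ → ℕ) (fun _ => 0) (fun x f t =>
    (fun t' => Bool.rec (add t' (f t')) t' (ble t' 67108864))
      (div (mul t (mul (Nat.succ x) A')) (mul (sub n x) A))) x

/-- Certifies `1 / 10 ≤ midTail n m (A / 2 ^ 24)` when `c = n.choose m`. -/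
def tailOK (n m c A : ℕ) : Bool :=
  (fun t => ble 1099511627776 (mul 10 (add (div t 2) (tailSum A (sub 16777216 A) n m t))))
   (div (mul c (mul (pow A m) (pow (sub 16777216 A) (sub n m)))) (pow 2 (sub (mul 24 n) 40)))

/-- Certifies `Threshold i k (P / Q)`. -/
def fracOK (i k P Q : ℕ) : Bool :=
  and (ble Q P) (Bool.rec
    (ble (mul (add (mul 17 k) 48) (mul Q (add (mul k Q) (mul i P))))
      (mul 10 (mul i (mul (mul k k) (pow (sub P Q) 2)))))
    (ble (mul 17 (mul Q (add (mul k Q) (mul i P)))) (mul 10 (mul i (mul k (pow (sub P Q) 2)))))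
    (ble i k))

/-- Certifies the threshold condition for the harmonic mean of the scaled odds of
`U / 2 ^ 24` and `V / 2 ^ 24`. -/
def pairOK (i k U V : ℕ) : Bool :=
  fracOK i k (mul 2 (mul k (mul U V)))
    (mul i (add (mul U (sub 16777216 V)) (mul V (sub 16777216 U))))

def sqrtIter (x s : ℕ) : ℕ → ℕ :=
  Nat.rec (motive := fun _ => ℕ → ℕ) (fun r => r)
    (fun _ f r => f (div (add r (div x r)) 2)) s

def guessAux (a w b : ℕ) (x : ℕ) : ℕ :=
  div (mul 16777216 (add b (sqrtIter x 12 b))) (add (mul a a) w)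

/-- A heuristic approximation from below to `2 ^ 24` times the solution of
`midTail n m p = 1 / 10`. -/
def guess (n m : ℕ) : ℕ :=
  (fun z => (fun d => (fun a => (fun c => (fun w =>
    guessAux a w (add (mul a c) (div w 2)) (mul w (sub (add (mul a c) (div w 4)) (mul c c))))
    (mul 3600000000 (mul z (mul z n))))
    (sub (mul 600000000 m) d))
    (sub (mul 600000000 n) (mul 2 d)))
    (sub (mul z z) 100000000))
    (add 12815 (add (div 400 m) (div 1120 (sub n m))))

def stepOK (n m c U V : ℕ) : Bool :=
    and (tailOK n (Nat.succ m) c V) (pairOK (Nat.succ m) (sub n m) U V)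

def rowOK (n s : ℕ) : ℕ → ℕ → ℕ → Bool :=
  Nat.rec (motive := fun _ => ℕ → ℕ → ℕ → Bool) (fun _ _ _ => true)
  (fun _ f m c U => (fun c' V => and (stepOK n m c' U V) (f (Nat.succ m) c' V))
    (div (mul c (sub n m)) (Nat.succ m)) (guess n (Nat.succ m))) s

def fullRow (n : ℕ) : Bool :=
  (fun U => and (tailOK n 1 n U) (rowOK n (sub n 2) 1 n U)) (guess n 1)

def rows (N : ℕ) : Bool :=
  Nat.rec (motive := fun _ => Bool) true (fun N ih => and (fullRow (add N 3)) ih) N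

lemma tailSum_succ (A A' n x t : ℕ) : tailSum A A' n (x + 1) t =
    if t * ((x + 1) * A') / ((n - x) * A) ≤ 67108864 then t * ((x + 1) * A') / ((n - x) * A)
    else t * ((x + 1) * A') / ((n - x) * A)
      + tailSum A A' n x (t * ((x + 1) * A') / ((n - x) * A)) := by
  have : tailSum A A' n (x + 1) t = Bool.rec (t * ((x + 1) * A') / ((n - x) * A)
      + tailSum A A' n x (t * ((x + 1) * A') / ((n - x) * A)))
      (t * ((x + 1) * A') / ((n - x) * A))
      (Nat.ble (t * ((x + 1) * A') / ((n - x) * A)) 67108864) := rfl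
  rw [this]
  split_ifs with h
  · rw [Nat.ble_eq_true_of_le h]
  · rw [Bool.eq_false_iff.2 (fun h' => h (Nat.le_of_ble_eq_true h'))]

lemma tailSum_zero (A A' n x : ℕ) : tailSum A A' n x 0 = 0 := by
  induction x with
  | zero => rfl
  | succ x ih => simp [tailSum_succ]

lemma tailSum_le {A A' n : ℕ} {S p : ℝ} (hA : 0 < A) (hS : 0 ≤ S) (hp : p * (A + A') = A)
    (x t : ℕ) (hx : x ≤ n) (ht : t ≤ S * B n x p) :
    (tailSum A A' n x t : ℝ) ≤ S * ∑ y ∈ Finset.range x, B n y p := by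
  have hA' : (0 : ℝ) < A := by exact_mod_cast hA
  have hAA : (0 : ℝ) < A + A' := by positivity
  have hp0 : 0 < p := by
    by_contra! h
    nlinarith
  have hp1 : p ≤ 1 := by
    by_contra! h
    have : (0 : ℝ) ≤ A' := by positivity
    nlinarith
  have hq : (1 - p) * (A + A') = A' := by linarith
  induction x generalizing t with
  | zero => simp [tailSum]
  | succ x ih =>
    have hnx : (0 : ℝ) < n - x := by
      have : (x : ℝ) < n := by exact_mod_cast hx
      linarith
    obtain ⟨t', ht'⟩ : ∃ t', t' = t * ((x + 1) * A') / ((n - x) * A) := ⟨_, rfl⟩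
    have h1 : (t' : ℝ) ≤ S * B n x p := by
      have h2 : (t' : ℝ) ≤ t * ((x + 1) * A') / ((n - x) * A) := by
        rw [ht']
        refine Nat.cast_div_le.trans (le_of_eq ?_)
        push_cast [Nat.cast_sub (Nat.le_of_succ_le hx)]
        rfl
      refine h2.trans ?_
      rw [div_le_iff₀ (by positivity)]
      have h3 : (t : ℝ) * ((x + 1) * A') ≤ S * B n (x + 1) p * ((x + 1) * A') := by gcongr
      have h4 := B_succ_mul n x hx p
      have h5 : B n (x + 1) p * ((x + 1) * A') = B n x p * ((n - x) * A) := by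
        linear_combination (A + A' : ℝ) * h4 - B n (x + 1) p * (x + 1) * hq + B n x p * (n - x) * hp
      linear_combination h3 + S * h5
    have h6 := B_nonneg n x hp0.le hp1
    rw [tailSum_succ, Finset.sum_range_succ, ← ht']
    split_ifs with h
    · have : 0 ≤ ∑ y ∈ Finset.range x, B n y p :=
        Finset.sum_nonneg fun y _ => B_nonneg n y hp0.le hp1
      have : 0 ≤ S * ∑ y ∈ Finset.range x, B n y p := by positivity
      linarith
    · push_cast
      linarith [ih t' (Nat.le_of_succ_le hx) h1]

lemma le_of_tailOK {n m c A t : ℕ} (h : tailOK n m c A = true)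
    (ht : t = c * (A ^ m * (16777216 - A) ^ (n - m)) / 2 ^ (24 * n - 40)) :
    1099511627776 ≤ 10 * (t / 2 + tailSum A (16777216 - A) n m t) := by
  rw [ht]
  exact Nat.le_of_ble_eq_true h

lemma pos_and_lt_of_tailOK {n m c A : ℕ} (hm : 1 ≤ m) (hmn : m < n) (h : tailOK n m c A = true) :
    0 < A ∧ A < 16777216 := by
  have key : A ^ m * (16777216 - A) ^ (n - m) ≠ 0 := by
    intro h0
    have h1 := le_of_tailOK h rfl
    simp only [h0, mul_zero, Nat.zero_div, tailSum_zero] at h1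
    omega
  constructor
  · rw [Nat.pos_iff_ne_zero]
    rintro rfl
    simp [show m ≠ 0 by omega] at key
  · by_contra! hA
    rw [Nat.sub_eq_zero_of_le hA, zero_pow (by omega)] at key
    simp at key

lemma le_midTail_of_tailOK {n m A : ℕ} (hn : 2 ≤ n) (hm : 1 ≤ m) (hmn : m < n)
    (h : tailOK n m (n.choose m) A = true) : 1 / 10 ≤ midTail n m (A / 16777216) := by
  obtain ⟨hA0, hA1⟩ := pos_and_lt_of_tailOK hm hmn h
  obtain ⟨A', hA'⟩ := Nat.exists_eq_add_of_lt hA1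
  obtain ⟨p, hp⟩ : ∃ p : ℝ, p = A / 16777216 := ⟨_, rfl⟩
  have hs : 16777216 - A = A' + 1 := by omega
  have hAr : (A : ℝ) + (A' + 1 : ℕ) = 16777216 := by
    rw [← Nat.cast_add, ← add_assoc, ← hA']
    norm_num
  obtain ⟨t, ht⟩ : ∃ t, t = n.choose m * (A ^ m * (A' + 1) ^ (n - m)) / 2 ^ (24 * n - 40) :=
    ⟨_, rfl⟩
  have h1 : 1099511627776 ≤ 10 * (t / 2 + tailSum A (A' + 1) n m t) := by
    rw [← hs]
    exact le_of_tailOK h (by rw [ht, hs])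
  have htB : (t : ℝ) ≤ 1099511627776 * B n m p := by
    rw [ht]
    refine Nat.cast_div_le.trans (le_of_eq ?_)
    have e2 : (2 : ℝ) ^ (24 * n - 40) * 1099511627776 = 16777216 ^ n := by
      rw [show (1099511627776 : ℝ) = 2 ^ 40 by norm_num, ← pow_add,
        show 24 * n - 40 + 40 = 24 * n by omega, pow_mul]
      norm_num
    have e3 : (16777216 : ℝ) ^ n = 16777216 ^ m * 16777216 ^ (n - m) := by
      rw [← pow_add, show m + (n - m) = n by omega]
    have hq : 1 - p = (A' + 1 : ℕ) / 16777216 := by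
      rw [hp, ← hAr]
      field_simp
      ring
    rw [B, hq, hp, Nat.cast_mul, Nat.cast_mul, Nat.cast_pow, Nat.cast_pow, Nat.cast_pow, div_pow,
      div_pow, div_eq_iff (by positivity)]
    rw [e3] at e2
    push_cast
    field_simp
    linear_combination -(n.choose m : ℝ) * e2
  have h2 := tailSum_le (S := 1099511627776) (p := p) hA0 (by norm_num)
    (by rw [hAr, hp]; field_simp) m t hmn.le htB
  have h3 : (1099511627776 : ℝ) ≤ 10 * (t / 2 + tailSum A (A' + 1) n m t) := by
    have h4 : (1099511627776 : ℝ) ≤ 10 * ((t / 2 : ℕ) + tailSum A (A' + 1) n m t) := by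
      exact_mod_cast h1
    have h5 : ((t / 2 : ℕ) : ℝ) ≤ t / 2 := by exact_mod_cast Nat.cast_div_le (m := t) (n := 2)
    linarith
  rw [← hp, midTail]
  linarith

lemma threshold_of_fracOK {i k P Q : ℕ} (hQ : 0 < Q) (h : fracOK i k P Q = true) :
    Threshold i k (P / Q) := by
  have hQ' : (0 : ℝ) < Q := by exact_mod_cast hQ
  rw [fracOK, Bool.and_eq_true] at h
  obtain ⟨h1, h2⟩ := h
  replace h1 := Nat.le_of_ble_eq_true h1
  have h1' : (Q : ℝ) ≤ P := by exact_mod_cast h1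
  refine ⟨by rwa [le_div_iff₀ hQ', one_mul], fun hik => ?_, fun hik => ?_⟩
  · have hik' : i ≤ k := by exact_mod_cast hik
    rw [Nat.ble_eq_true_of_le hik'] at h2
    replace h2 := Nat.le_of_ble_eq_true h2
    simp only [Nat.mul_eq, Nat.pow_eq, Nat.sub_eq, Nat.add_eq] at h2
    have h3 : (17 : ℝ) * (Q * (k * Q + i * P)) ≤ 10 * (i * (k * (P - Q) ^ 2)) := by
      rw [← Nat.cast_sub h1]
      exact_mod_cast h2
    refine le_of_mul_le_mul_right ?_ (show 0 < 10 * (Q : ℝ) ^ 2 by positivity)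
    refine le_of_eq_of_le ?_ (h3.trans_eq ?_)
    · field_simp
      ring
    · field_simp
  · have hik' : ¬ i ≤ k := by
      rw [not_le]
      exact_mod_cast hik
    rw [Bool.eq_false_iff.2 (fun h' => hik' (Nat.le_of_ble_eq_true h'))] at h2
    replace h2 := Nat.le_of_ble_eq_true h2
    simp only [Nat.mul_eq, Nat.pow_eq, Nat.sub_eq, Nat.add_eq] at h2
    have h3 : (17 * k + 48 : ℝ) * (Q * (k * Q + i * P)) ≤ 10 * (i * (k * k * (P - Q) ^ 2)) := by
      rw [← Nat.cast_sub h1]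
      exact_mod_cast h2
    refine le_of_mul_le_mul_right ?_ (show 0 < 10 * (Q : ℝ) ^ 2 by positivity)
    refine le_of_eq_of_le ?_ (h3.trans_eq ?_)
    · field_simp
      ring
    · field_simp

end TailCheck

/-- `n` times the binomial mass function with parameters `n - 1` and `i - 1`. -/
noncomputable def BDeriv (n i : ℕ) (p : ℝ) : ℝ :=
  i * n.choose i * p ^ (i - 1) * (1 - p) ^ (n - i)

lemma hasDerivAt_B (n i : ℕ) (p : ℝ) :
    HasDerivAt (B n i) (BDeriv n i p - BDeriv n (i + 1) p) p := by
  have h2 : HasDerivAt (fun t : ℝ => (1 - t) ^ (n - i))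
      ((n - i : ℕ) * (1 - p) ^ (n - i - 1) * (-1)) p := by
    exact ((hasDerivAt_id p).const_sub 1).fun_pow (n - i)
  have h := ((hasDerivAt_pow i p).const_mul (n.choose i : ℝ)).mul h2
  have hc : (n.choose (i + 1) : ℝ) * (i + 1 : ℕ) = n.choose i * (n - i : ℕ) := by
    exact_mod_cast Nat.choose_succ_right_eq n i
  refine h.congr_deriv ?_
  simp only [BDeriv, Nat.add_sub_cancel, ← Nat.sub_sub]
  linear_combination p ^ i * (1 - p) ^ (n - i - 1) * hc

lemma hasDerivAt_sum_B (n i : ℕ) (p : ℝ) :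
    HasDerivAt (fun t => ∑ x ∈ Finset.range i, B n x t) (-BDeriv n i p) p := by
  refine (HasDerivAt.fun_sum fun x _ => hasDerivAt_B n x p).congr_deriv ?_
  rw [Finset.sum_range_sub']
  simp [BDeriv]

lemma hasDerivAt_midTail (n m : ℕ) (p : ℝ) :
    HasDerivAt (midTail n m) (-(BDeriv n m p + BDeriv n (m + 1) p) / 2) p :=
  ((hasDerivAt_sum_B n m p).add ((hasDerivAt_B n m p).const_mul (1 / 2))).congr_deriv (by ring)

lemma BDeriv_nonneg (n i : ℕ) {p : ℝ} (h0 : 0 ≤ p) (h1 : p ≤ 1) : 0 ≤ BDeriv n i p := by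
  have : 0 ≤ 1 - p := by linarith
  unfold BDeriv
  positivity

lemma BDeriv_pos {n i : ℕ} (hi : 1 ≤ i) (hn : i ≤ n) {p : ℝ} (h0 : 0 < p) (h1 : p < 1) :
    0 < BDeriv n i p := by
  have : 0 < 1 - p := by linarith
  have : 0 < n.choose i := Nat.choose_pos hn
  unfold BDeriv
  positivity

lemma BDeriv_add_pos {n m : ℕ} (hn : 1 ≤ n) (hm : m ≤ n) {p : ℝ} (h0 : 0 < p) (h1 : p < 1) :
    0 < BDeriv n m p + BDeriv n (m + 1) p := by
  rcases hm.eq_or_lt with rfl | hm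
  · exact add_pos_of_pos_of_nonneg (BDeriv_pos hn le_rfl h0 h1) (BDeriv_nonneg _ _ h0.le h1.le)
  · exact add_pos_of_nonneg_of_pos (BDeriv_nonneg _ _ h0.le h1.le)
      (BDeriv_pos (by omega) (by omega) h0 h1)

lemma strictAntiOn_midTail {n m : ℕ} (hn : 1 ≤ n) (hm : m ≤ n) :
    StrictAntiOn (midTail n m) (Set.Icc 0 1) := by
  refine strictAntiOn_of_deriv_neg (convex_Icc 0 1)
    (fun p _ => (hasDerivAt_midTail n m p).continuousAt.continuousWithinAt) fun p hp => ?_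
  rw [interior_Icc] at hp
  rw [(hasDerivAt_midTail n m p).deriv]
  linarith [BDeriv_add_pos hn hm hp.1 hp.2]

lemma midTail_zero {n m : ℕ} (hm : 1 ≤ m) : midTail n m 0 = 1 := by
  obtain ⟨m, rfl⟩ := Nat.exists_eq_add_of_le' hm
  simp [midTail, B, Finset.sum_range_succ']

lemma midTail_one {n m : ℕ} (hm : m < n) : midTail n m 1 = 0 := by
  have : ∀ x ≤ m, B n x 1 = 0 := fun x hx => by
    rw [B, sub_self, zero_pow (by omega), mul_zero]
  rw [midTail, this m le_rfl, Finset.sum_eq_zero fun x hx =>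
    this x (Finset.mem_range.1 hx).le]
  norm_num

lemma midTail_succ (n m : ℕ) (p : ℝ) :
    midTail n (m + 1) p = midTail n m p + (B n m p + B n (m + 1) p) / 2 := by
  rw [midTail, midTail, Finset.sum_range_succ]
  ring

lemma sum_Icc_B {n i : ℕ} (hi : i ≤ n + 1) (p : ℝ) :
    ∑ x ∈ Finset.Icc i n, B n x p = 1 - ∑ x ∈ Finset.range i, B n x p := by
  have h : ∑ x ∈ Finset.range (n + 1), B n x p = 1 := by
    have := add_pow p (1 - p) n
    rw [add_sub_cancel, one_pow] at this
    rw [this]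
    exact Finset.sum_congr rfl fun x _ => by rw [B]; ring
  rw [eq_sub_iff_add_eq', ← h, ← Finset.sum_range_add_sum_Ico _ hi]
  rfl

lemma exists_inverse_of_hasDerivAt {M M' : ℝ → ℝ} (hM : ∀ p, HasDerivAt M (M' p) p)
    (hneg : ∀ p ∈ Set.Ioo (0 : ℝ) 1, M' p < 0) (h0 : M 0 = 1) (h1 : M 1 = 0) :
    ∃ g : ℝ → ℝ, ∀ y ∈ Set.Ioo (0 : ℝ) 1,
      g y ∈ Set.Ioo (0 : ℝ) 1 ∧ M (g y) = y ∧ HasDerivAt g (M' (g y))⁻¹ y := by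
  have hcont : ContinuousOn M (Set.Icc 0 1) := fun p _ => (hM p).continuousAt.continuousWithinAt
  have hanti : StrictAntiOn M (Set.Icc 0 1) := by
    refine strictAntiOn_of_deriv_neg (convex_Icc 0 1) hcont fun p hp => ?_
    rw [interior_Icc] at hp
    rw [(hM p).deriv]
    exact hneg p hp
  have hex : ∀ y, ∃ p, y ∈ Set.Ioo (0 : ℝ) 1 → p ∈ Set.Ioo (0 : ℝ) 1 ∧ M p = y := by
    intro y
    by_cases hy : y ∈ Set.Ioo (0 : ℝ) 1
    · obtain ⟨p, hp, hpy⟩ := intermediate_value_Ioo' zero_le_one hcont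
        (show y ∈ Set.Ioo (M 1) (M 0) by rwa [h0, h1])
      exact ⟨p, fun _ => ⟨hp, hpy⟩⟩
    · exact ⟨0, fun h => absurd h hy⟩
  choose g hg using hex
  have hgI : ∀ {y}, y ∈ Set.Ioo (0 : ℝ) 1 → g y ∈ Set.Icc (0 : ℝ) 1 := fun hy =>
    Set.Ioo_subset_Icc_self (hg _ hy).1
  have himage : g '' Set.Ioo 0 1 = Set.Ioo 0 1 := by
    ext p
    constructor
    · rintro ⟨y, hy, rfl⟩
      exact (hg y hy).1
    · intro hp
      have hpI := Set.Ioo_subset_Icc_self hp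
      have hMp : M p ∈ Set.Ioo (0 : ℝ) 1 := by
        constructor
        · rw [← h1]
          exact hanti hpI (by simp) hp.2
        · rw [← h0]
          exact hanti (by simp) hpI hp.1
      exact ⟨M p, hMp, hanti.injOn (hgI hMp) hpI (hg _ hMp).2⟩
  have hmono : StrictMonoOn (fun y => -g y) (Set.Ioo 0 1) := by
    intro y hy z hz hyz
    by_contra! h
    have := hanti.antitoneOn (hgI hy) (hgI hz) (neg_le_neg_iff.1 h)
    rw [(hg y hy).2, (hg z hz).2] at this
    exact this.not_gt hyz
  refine ⟨g, fun y hy => ⟨(hg y hy).1, (hg y hy).2, ?_⟩⟩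
  have hc : ContinuousAt g y := by
    have h : ContinuousAt (fun y => -g y) y := by
      refine hmono.continuousAt_of_image_mem_nhds (isOpen_Ioo.mem_nhds hy) ?_
      have : (fun y => -g y) '' Set.Ioo 0 1 = Set.Ioo (-1) 0 := by
        rw [← Set.image_image Neg.neg g, himage]
        simp
      rw [this]
      have := (hg y hy).1
      exact isOpen_Ioo.mem_nhds ⟨by linarith [this.2], by linarith [this.1]⟩
    simpa only [neg_neg] using h.fun_neg
  refine HasDerivAt.of_local_left_inverse hc (hM (g y)) (hneg _ (hg y hy).1).ne ?_
  filter_upwards [isOpen_Ioo.mem_nhds hy] with z hz using (hg z hz).2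

lemma nonpos_of_deriv_nonpos_of_pos {P P' : ℝ → ℝ} {c d : ℝ} (hd : 0 < d)
    (hP : ∀ t, 0 < t → t ≤ d → HasDerivAt P (P' t) t)
    (hP' : ∀ t, 0 < t → t ≤ d → 0 < P t → P' t ≤ 0)
    (hc : ∀ t, 0 < t → t ≤ d → P t ≤ c * t) : P d ≤ 0 := by
  by_contra! hpos
  have hc0 : 0 < c := by
    by_contra! h
    nlinarith [hc d hd le_rfl]
  obtain ⟨s, hs0, hsd, hs⟩ : ∃ s, 0 < s ∧ s ≤ d ∧ P s ≤ P d / 2 := by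
    have h := hc d hd le_rfl
    refine ⟨P d / (2 * c), by positivity, ?_, (hc _ (by positivity) ?_).trans_eq ?_⟩
    · rw [div_le_iff₀ (by positivity)]
      nlinarith
    · rw [div_le_iff₀ (by positivity)]
      nlinarith
    · field_simp
  have hcont : ContinuousOn P (Set.Icc s d) := fun t ht =>
    (hP t (hs0.trans_le ht.1) ht.2).continuousAt.continuousWithinAt
  have hcomp : IsCompact (Set.Icc s d ∩ P ⁻¹' Set.Iic (P d / 2)) :=
    isCompact_Icc.of_isClosed_subset (hcont.preimage_isClosed_of_isClosed isClosed_Icc isClosed_Iic)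
      Set.inter_subset_left
  obtain ⟨τ, ⟨⟨hτs, hτd⟩, hτ⟩, hmax⟩ := hcomp.exists_isGreatest ⟨s, ⟨le_rfl, hsd⟩, hs⟩
  have hτ' : P τ ≤ P d / 2 := hτ
  have hanti : AntitoneOn P (Set.Icc τ d) := by
    refine antitoneOn_of_deriv_nonpos (convex_Icc τ d)
      (hcont.mono (Set.Icc_subset_Icc_left hτs)) ?_ ?_
    · rw [interior_Icc]
      intro t ht
      exact (hP t (by linarith [ht.1]) ht.2.le).differentiableAt.differentiableWithinAt
    · rw [interior_Icc]
      intro t ht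
      have ht0 : 0 < t := by linarith [ht.1]
      rw [(hP t ht0 ht.2.le).deriv]
      refine hP' t ht0 ht.2.le ?_
      by_contra! h
      have hle : P t ≤ P d / 2 := by linarith
      exact ht.1.not_ge (hmax ⟨⟨by linarith [ht.1], ht.2.le⟩, hle⟩)
  linarith [hanti ⟨le_rfl, hτd⟩ ⟨hτd, le_rfl⟩ hτd]

lemma Threshold.mono {i k H H' : ℝ} (hi : 0 < i) (hk : 0 < k) (h : Threshold i k H)
    (hH : H ≤ H') : Threshold i k H' := by
  obtain ⟨h1, h2, h3⟩ := h
  have h1' : 1 ≤ H' := h1.trans hH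
  have hc : 0 < k + i * H := by positivity
  have hc' : 0 < k + i * H' := by positivity
  have key : (H - 1) ^ 2 * (k + i * H') ≤ (H' - 1) ^ 2 * (k + i * H) := by
    have e1 : 0 ≤ (k + i) * (H' - H) * ((H' - 1) + (H - 1)) := by
      have : 0 ≤ H' - H := by linarith
      have : 0 ≤ (H' - 1) + (H - 1) := by linarith
      positivity
    have e2 : 0 ≤ i * ((H' - 1) * (H - 1) * (H' - H)) := by
      have : 0 ≤ H' - H := by linarith
      have : 0 ≤ H' - 1 := by linarith
      have : 0 ≤ H - 1 := by linarith
      positivity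
    linarith
  have aux : ∀ {c d : ℝ}, 0 ≤ d → c * (k + i * H) ≤ d * (H - 1) ^ 2 →
      c * (k + i * H') ≤ d * (H' - 1) ^ 2 := by
    intro c d hd hcd
    refine le_of_mul_le_mul_right ?_ hc
    have := mul_le_mul_of_nonneg_right hcd hc'.le
    have := mul_le_mul_of_nonneg_left key hd
    linarith
  exact ⟨h1', fun h => aux (by positivity) (h2 h), fun h => aux (by positivity) (h3 h)⟩

lemma Threshold.mono_of_le {i k a b a' b' : ℝ} (hi : 0 < i) (hk : 0 < k) (ha : 0 < a)
    (hb : 0 < b) (haa : a ≤ a') (hbb : b ≤ b') (ha' : a' < 1) (hb' : b' < 1)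
    (h : Threshold i k (2 * (k * a * b) / (i * (a * (1 - b) + b * (1 - a))))) :
    Threshold i k (2 * (k * a' * b') / (i * (a' * (1 - b') + b' * (1 - a')))) := by
  refine h.mono hi hk ?_
  have ha1 : 0 < 1 - a := by linarith
  have hb1 : 0 < 1 - b := by linarith
  have ha1' : 0 < 1 - a' := by linarith
  have hb1' : 0 < 1 - b' := by linarith
  have ha0' : 0 < a' := by linarith
  have hb0' : 0 < b' := by linarith
  have e : ∀ {s t : ℝ}, 0 < s → 0 < t → s < 1 → t < 1 →
      2 * (k * s * t) / (i * (s * (1 - t) + t * (1 - s)))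
        = 2 * k / (i * ((1 - t) / t + (1 - s) / s)) := by
    intro s t hs ht hs1 ht1
    have : 0 < 1 - s := by linarith
    have : 0 < 1 - t := by linarith
    field_simp
  rw [e ha hb (by linarith) (by linarith), e ha0' hb0' ha' hb']
  gcongr

namespace TailCheck

lemma threshold_of_pairOK {i k U V : ℕ} (hi : 0 < i) (hU : 0 < U) (hU1 : U < 16777216)
    (hV1 : V < 16777216) (h : pairOK i k U V = true) :
    Threshold i k (2 * (k * (U / 16777216) * (V / 16777216)) /
      (i * (U / 16777216 * (1 - V / 16777216) + V / 16777216 * (1 - U / 16777216)))) := by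
  have h1 := threshold_of_fracOK (P := 2 * (k * (U * V)))
    (Q := i * (U * (16777216 - V) + V * (16777216 - U))) ?_ h
  · convert h1 using 1
    push_cast [Nat.cast_sub hU1.le, Nat.cast_sub hV1.le]
    have hV' : (V : ℝ) < 16777216 := by exact_mod_cast hV1
    have hU' : (U : ℝ) < 16777216 := by exact_mod_cast hU1
    have hU0' : (0 : ℝ) < U := by exact_mod_cast hU
    have hi' : (0 : ℝ) < i := by exact_mod_cast hi
    have : 0 < (U : ℝ) * (16777216 - V) + V * (16777216 - U) := by
      have := mul_pos hU0' (sub_pos.2 hV')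
      have : 0 ≤ (V : ℝ) * (16777216 - U) := mul_nonneg (by positivity) (by linarith)
      linarith
    rw [show (U : ℝ) / 16777216 * (1 - V / 16777216) + V / 16777216 * (1 - U / 16777216)
      = (U * (16777216 - V) + V * (16777216 - U)) / 16777216 ^ 2 by field_simp]
    field_simp
  · have : 0 < U * (16777216 - V) := Nat.mul_pos hU (by omega)
    positivity

lemma rowOK_spec {n s m c U : ℕ} (hc : c = n.choose m) (hU : U = guess n m)
    (h : rowOK n s m c U = true) (j : ℕ) (hmj : m ≤ j) (hjs : j < m + s) :
    stepOK n j (n.choose (j + 1)) (guess n j) (guess n (j + 1)) = true := by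
  induction s generalizing m c U with
  | zero => omega
  | succ s ih =>
    have hc' : c * (n - m) / (m + 1) = n.choose (m + 1) := by
      rw [hc, ← Nat.choose_succ_right_eq]
      exact Nat.mul_div_cancel _ m.succ_pos
    have h' : (stepOK n m (c * (n - m) / (m + 1)) U (guess n (m + 1)) &&
      rowOK n s (m + 1) (c * (n - m) / (m + 1)) (guess n (m + 1))) = true := h
    rw [hc', hU, Bool.and_eq_true] at h'
    rcases hmj.eq_or_lt with rfl | hlt
    · exact h'.1
    · exact ih rfl rfl h'.2 hlt (by omega)

lemma fullRow_of_rows {N : ℕ} (h : rows N = true) {n : ℕ} (hn : n < N) :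
    fullRow (n + 3) = true := by
  induction N with
  | zero => omega
  | succ N ih =>
    have h' : (fullRow (N + 3) && rows N) = true := h
    rw [Bool.and_eq_true] at h'
    rcases (Nat.lt_succ_iff.1 hn).eq_or_lt with rfl | hlt
    · exact h'.1
    · exact ih h'.2 hlt

lemma spec_of_fullRow {I K : ℕ} (hI : 1 ≤ I) (hK : 1 ≤ K) (h : fullRow (I + K + 1) = true) :
    ∃ U V : ℕ, tailOK (I + K + 1) I ((I + K + 1).choose I) U = true ∧
      tailOK (I + K + 1) (I + 1) ((I + K + 1).choose (I + 1)) V = true ∧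
      pairOK (I + 1) (K + 1) U V = true := by
  have h' : (tailOK (I + K + 1) 1 (I + K + 1) (guess (I + K + 1) 1) &&
    rowOK (I + K + 1) (I + K + 1 - 2) 1 (I + K + 1) (guess (I + K + 1) 1)) = true := h
  rw [Bool.and_eq_true] at h'
  have hstep : ∀ j, 1 ≤ j → j < I + K → stepOK (I + K + 1) j ((I + K + 1).choose (j + 1))
      (guess (I + K + 1) j) (guess (I + K + 1) (j + 1)) = true := fun j hj hj' =>
    rowOK_spec (Nat.choose_one_right _).symm rfl h'.2 j hj (by omega)
  refine ⟨guess (I + K + 1) I, guess (I + K + 1) (I + 1), ?_, ?_, ?_⟩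
  · obtain ⟨J, rfl⟩ := Nat.exists_eq_add_of_le' hI
    rcases Nat.eq_zero_or_pos J with rfl | hJ
    · simpa using h'.1
    · exact (Bool.and_eq_true_iff.1 (hstep J hJ (by omega))).1
  · exact (Bool.and_eq_true_iff.1 (hstep I hI (by omega))).1
  · have := (Bool.and_eq_true_iff.1 (hstep I hI (by omega))).2
    rwa [Nat.sub_eq, show I + K + 1 - I = K + 1 by omega] at this

lemma rows_eq_true : rows 198 = true := by
  decide +kernel

end TailCheck

lemma threshold_of_midTail_lt {I K : ℕ} (hI : 1 ≤ I) (hK : 1 ≤ K) (hn : I + K + 1 ≤ 200)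
    {a b : ℝ} (ha0 : 0 < a) (ha1 : a < 1) (hb0 : 0 < b) (hb1 : b < 1)
    (ha : midTail (I + K + 1) I a < 1 / 10) (hb : midTail (I + K + 1) (I + 1) b < 1 / 10) :
    Threshold (I + 1) (K + 1)
      (2 * ((K + 1) * a * b) / ((I + 1) * (a * (1 - b) + b * (1 - a)))) := by
  have hrow : TailCheck.fullRow (I + K + 1) = true := by
    have := TailCheck.fullRow_of_rows TailCheck.rows_eq_true (n := I + K - 2) (by omega)
    rwa [show I + K - 2 + 3 = I + K + 1 by omega] at this
  obtain ⟨U, V, hU, hV, hUV⟩ := TailCheck.spec_of_fullRow hI hK hrow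
  obtain ⟨hU0, hU1⟩ := TailCheck.pos_and_lt_of_tailOK hI (by omega) hU
  obtain ⟨hV0, hV1⟩ := TailCheck.pos_and_lt_of_tailOK (by omega) (by omega) hV
  have key : ∀ {m A : ℕ} {c : ℝ}, m ≤ I + K + 1 → 0 < A → A < 16777216 → 0 < c → c < 1 →
      midTail (I + K + 1) m c < 1 / 10 → 1 / 10 ≤ midTail (I + K + 1) m (A / 16777216) →
      (A : ℝ) / 16777216 ≤ c := by
    intro m A c hm hA0 hA1 hc0 hc1 hc hA
    have hA1' : (A : ℝ) ≤ 16777216 := by exact_mod_cast hA1.le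
    by_contra! h
    exact (hc.trans_le hA).not_ge (strictAntiOn_midTail (by omega) hm ⟨hc0.le, hc1.le⟩
      ⟨by positivity, by rw [div_le_one (by norm_num)]; exact hA1'⟩ h).le
  have h := TailCheck.threshold_of_pairOK (by omega) hU0 hU1 hV1 hUV
  push_cast at h
  have hU0' : (0 : ℝ) < U := by exact_mod_cast hU0
  have hV0' : (0 : ℝ) < V := by exact_mod_cast hV0
  exact h.mono_of_le (by positivity) (by positivity) (by positivity) (by positivity)
    (key (by omega) hU0 hU1 ha0 ha1 ha (TailCheck.le_midTail_of_tailOK (by omega) hI (by omega) hU))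
    (key (by omega) hV0 hV1 hb0 hb1 hb (TailCheck.le_midTail_of_tailOK (by omega) (by omega) (by omega) hV))
    ha1 hb1

lemma BDeriv_mul (n i : ℕ) (p : ℝ) : BDeriv n i p * p = i * B n i p := by
  cases i with
  | zero => simp [BDeriv]
  | succ i =>
    rw [BDeriv, B, Nat.add_sub_cancel]
    ring

lemma BDeriv_succ_mul {n i : ℕ} (hi : i ≤ n) (p : ℝ) :
    BDeriv n (i + 1) p * (1 - p) = (n - i) * B n i p := by
  have hc : (n.choose (i + 1) : ℝ) * (i + 1) = n.choose i * (n - i) := by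
    rw [← Nat.cast_sub hi]
    exact_mod_cast Nat.choose_succ_right_eq n i
  rcases hi.eq_or_lt with rfl | hlt
  · simp [BDeriv]
  · rw [BDeriv, B, Nat.add_sub_cancel, show n - i = n - (i + 1) + 1 by omega]
    push_cast
    linear_combination p ^ i * (1 - p) ^ (n - (i + 1) + 1) * hc

lemma hasDerivAt_linear_mul_B {n i : ℕ} (hi : i ≤ n) (c d : ℝ) {p : ℝ} (h0 : 0 < p)
    (h1 : p < 1) : HasDerivAt (fun t => (c * (1 - t) + d * t) * B n i t)
      (((d - c) + (c * (1 - p) + d * p) * (i / p - (n - i) / (1 - p))) * B n i p) p := by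
  have hq : 1 - p ≠ 0 := by linarith
  have e1 : BDeriv n i p = i / p * B n i p := by
    rw [div_mul_eq_mul_div, ← BDeriv_mul, mul_div_cancel_right₀ _ h0.ne']
  have e2 : BDeriv n (i + 1) p = (n - i) / (1 - p) * B n i p := by
    rw [div_mul_eq_mul_div, ← BDeriv_succ_mul hi, mul_div_cancel_right₀ _ hq]
  have h : HasDerivAt (fun t => c * (1 - t) + d * t) (c * (-1) + d * 1) p :=
    (((hasDerivAt_id p).const_sub 1).const_mul c).add ((hasDerivAt_id p).const_mul d)
  refine (h.mul (hasDerivAt_B n i p)).congr_deriv ?_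
  rw [e1, e2]
  ring

lemma BDeriv_add_eq {n i : ℕ} (hi : i ≤ n) {p : ℝ} (h0 : 0 < p) (h1 : p < 1) :
    BDeriv n i p + BDeriv n (i + 1) p = (i / p + (n - i) / (1 - p)) * B n i p := by
  have hq : 1 - p ≠ 0 := by linarith
  rw [add_mul, div_mul_eq_mul_div, div_mul_eq_mul_div, ← BDeriv_mul, ← BDeriv_succ_mul hi,
    mul_div_cancel_right₀ _ h0.ne', mul_div_cancel_right₀ _ hq]

lemma hasDerivAt_linear_mul_B_left (I K : ℕ) {p : ℝ} (h0 : 0 < p) (h1 : p < 1) :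
    HasDerivAt (fun t => ((I + 1) * (1 - t) + (K + 1) * t) * B (I + K + 1) I t)
      (-(BDeriv (I + K + 1) I p + BDeriv (I + K + 1) (I + 1) p) / 2 *
        (2 * (I + K + 2) * (p + p * (1 - p) / (I * (1 - p) + (K + 1) * p)) - 2 * (I + 1))) p := by
  have hq : 0 < 1 - p := by linarith
  refine (hasDerivAt_linear_mul_B (by omega) (I + 1) (K + 1) h0 h1).congr_deriv ?_
  rw [BDeriv_add_eq (by omega) h0 h1]
  push_cast
  have hD : 0 < I * (1 - p) + (K + 1) * p := by positivity
  field_simp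
  ring

lemma hasDerivAt_linear_mul_B_right (I K : ℕ) {p : ℝ} (h0 : 0 < p) (h1 : p < 1) :
    HasDerivAt (fun t => ((I + 1) * (1 - t) + (K + 1) * t) * B (I + K + 1) (I + 1) t)
      (-(BDeriv (I + K + 1) (I + 1) p + BDeriv (I + K + 1) (I + 1 + 1) p) / 2 *
        (2 * (I + K + 2) * (p - p * (1 - p) / ((I + 1) * (1 - p) + K * p)) - 2 * (I + 1))) p := by
  have hq : 0 < 1 - p := by linarith
  refine (hasDerivAt_linear_mul_B (by omega) (I + 1) (K + 1) h0 h1).congr_deriv ?_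
  rw [BDeriv_add_eq (by omega) h0 h1]
  push_cast
  have hD : 0 < (I + 1) * (1 - p) + K * p := by positivity
  field_simp
  ring

lemma lt_of_midTail_eq {n m : ℕ} (hm : m < n) {a b : ℝ} (ha0 : 0 < a) (ha1 : a < 1)
    (hb0 : 0 ≤ b) (hb1 : b ≤ 1) (h : midTail n m a = midTail n (m + 1) b) : a < b := by
  by_contra! hba
  have h1 := (strictAntiOn_midTail (n := n) (m := m + 1) (by omega) (by omega)).antitoneOn
    ⟨hb0, hb1⟩ ⟨ha0.le, ha1.le⟩ hba
  rw [midTail_succ, ← h] at h1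
  have h2 : 0 < B n m a := by
    have : 0 < 1 - a := by linarith
    have : 0 < n.choose m := Nat.choose_pos hm.le
    unfold B
    positivity
  linarith [B_nonneg n (m + 1) ha0.le ha1.le]

lemma B_le_midTail (n m : ℕ) {p : ℝ} (h0 : 0 ≤ p) (h1 : p ≤ 1) : B n m p ≤ 2 * midTail n m p := by
  have : 0 ≤ ∑ x ∈ Finset.range m, B n x p := Finset.sum_nonneg fun x _ => B_nonneg n x h0 h1
  rw [midTail]
  linarith

lemma linear_mul_B_le {I K : ℕ} (hI : 1 ≤ I) (hK : 1 ≤ K) (hn : I + K + 1 ≤ 200) {α a b : ℝ}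
    (hα0 : 0 < α) (hα : α < 1 / 10) (ha0 : 0 < a) (ha1 : a < 1) (hb0 : 0 < b) (hb1 : b < 1)
    (ha : midTail (I + K + 1) I a = α) (hb : midTail (I + K + 1) (I + 1) b = α) :
    ((I + 1) * (1 - a) + (K + 1) * a) * B (I + K + 1) I a
      ≤ ((I + 1) * (1 - b) + (K + 1) * b) * B (I + K + 1) (I + 1) b := by
  obtain ⟨f, hf⟩ := exists_inverse_of_hasDerivAt (hasDerivAt_midTail (I + K + 1) I)
    (fun p hp => by
      have := BDeriv_add_pos (n := I + K + 1) (m := I) (by omega) (by omega) hp.1 hp.2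
      linarith) (midTail_zero hI) (midTail_one (by omega))
  obtain ⟨g, hg⟩ := exists_inverse_of_hasDerivAt (hasDerivAt_midTail (I + K + 1) (I + 1))
    (fun p hp => by
      have := BDeriv_add_pos (n := I + K + 1) (m := I + 1) (by omega) (by omega) hp.1 hp.2
      linarith) (midTail_zero (by omega)) (midTail_one (by omega))
  have hmem : ∀ t, 0 < t → t ≤ α → t ∈ Set.Ioo (0 : ℝ) 1 := fun t h h' => ⟨h, by linarith⟩
  have hfa : f α = a := by
    obtain ⟨h1, h2, -⟩ := hf α (hmem α hα0 le_rfl)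
    exact (strictAntiOn_midTail (by omega) (by omega)).injOn (Set.Ioo_subset_Icc_self h1)
      ⟨ha0.le, ha1.le⟩ (h2.trans ha.symm)
  have hgb : g α = b := by
    obtain ⟨h1, h2, -⟩ := hg α (hmem α hα0 le_rfl)
    exact (strictAntiOn_midTail (by omega) (by omega)).injOn (Set.Ioo_subset_Icc_self h1)
      ⟨hb0.le, hb1.le⟩ (h2.trans hb.symm)
  have key := nonpos_of_deriv_nonpos_of_pos (d := α) (c := 2 * (I + K + 2))
    (P := fun t => ((I + 1) * (1 - f t) + (K + 1) * f t) * B (I + K + 1) I (f t)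
      - ((I + 1) * (1 - g t) + (K + 1) * g t) * B (I + K + 1) (I + 1) (g t))
    (P' := fun t => 2 * (I + K + 2) *
      ((f t + f t * (1 - f t) / (I * (1 - f t) + (K + 1) * f t))
        - (g t - g t * (1 - g t) / ((I + 1) * (1 - g t) + K * g t)))) hα0 ?_ ?_ ?_
  · simp only [hfa, hgb] at key
    linarith
  · intro t ht0 ht
    obtain ⟨⟨h1, h2⟩, -, h4⟩ := hf t (hmem t ht0 ht)
    obtain ⟨⟨h5, h6⟩, -, h8⟩ := hg t (hmem t ht0 ht)
    have e1 := (hasDerivAt_linear_mul_B_left I K h1 h2).comp t h4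
    have e2 := (hasDerivAt_linear_mul_B_right I K h5 h6).comp t h8
    refine (e1.sub e2).congr_deriv ?_
    have d1 := BDeriv_add_pos (n := I + K + 1) (m := I) (by omega) (by omega) h1 h2
    have d2 := BDeriv_add_pos (n := I + K + 1) (m := I + 1) (by omega) (by omega) h5 h6
    have aux : ∀ {s r : ℝ}, 0 < s → -s / 2 * r * (-s / 2)⁻¹ = r := by
      intro s r hs
      field_simp
    rw [aux d1, aux d2]
    ring
  · intro t ht0 ht hpos
    obtain ⟨⟨h1, h2⟩, h3, -⟩ := hf t (hmem t ht0 ht)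
    obtain ⟨⟨h5, h6⟩, h7, -⟩ := hg t (hmem t ht0 ht)
    by_contra! hlt
    have hD := sub_pos.1 ((mul_pos_iff_of_pos_left (by positivity)).1 hlt)
    have hfg := lt_of_midTail_eq (by omega) h1 h2 h5.le h6.le (h3.trans h7.symm)
    have h := pow_mul_le_pow_mul_of_lt I K hI hK h1 hfg.le h6
      (threshold_of_midTail_lt hI hK hn h1 h2 h5 h6 (by linarith) (by linarith)) hD
    have hc : ((I + K + 1).choose (I + 1) : ℝ) * (I + 1) = (I + K + 1).choose I * (K + 1) := by
      have := Nat.choose_succ_right_eq (I + K + 1) I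
      rw [show I + K + 1 - I = K + 1 by omega] at this
      exact_mod_cast this
    refine hpos.not_ge (sub_nonpos.2 ?_)
    rw [B, B, show I + K + 1 - I = K + 1 by omega, show I + K + 1 - (I + 1) = K by omega]
    refine le_of_mul_le_mul_right ?_ (show (0 : ℝ) < I + 1 by positivity)
    have h9 := mul_le_mul_of_nonneg_left h (Nat.cast_nonneg (α := ℝ) ((I + K + 1).choose I))
    linear_combination h9 - ((I + 1) * (1 - g t) + (K + 1) * g t) * (g t ^ (I + 1) * (1 - g t) ^ K) * hc
  · intro t ht0 ht
    obtain ⟨⟨h1, h2⟩, h3, -⟩ := hf t (hmem t ht0 ht)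
    obtain ⟨⟨h5, h6⟩, -, -⟩ := hg t (hmem t ht0 ht)
    have h9 := B_le_midTail (I + K + 1) I h1.le h2.le
    have h10 := B_nonneg (I + K + 1) I h1.le h2.le
    have h11 := B_nonneg (I + K + 1) (I + 1) h5.le h6.le
    have h12 : 0 < 1 - f t := by linarith
    have h13 : 0 < 1 - g t := by linarith
    have h14 : 0 ≤ ((I + 1) * (1 - g t) + (K + 1) * g t) * B (I + K + 1) (I + 1) (g t) := by
      positivity
    have h15 : (I + 1) * (1 - f t) + (K + 1) * f t ≤ (I + K + 2 : ℝ) := by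
      have : 0 ≤ (I + 1) * f t := by positivity
      have : 0 ≤ (K + 1) * (1 - f t) := by positivity
      linarith
    have h16 : ((I + 1) * (1 - f t) + (K + 1) * f t) * B (I + K + 1) I (f t)
        ≤ (I + K + 2) * (2 * t) := by
      rw [h3] at h9
      gcongr
    linarith

lemma integral_sum_B_ge (I K : ℕ) {α a b : ℝ} (ha : midTail (I + K + 1) I a = α)
    (hb : midTail (I + K + 1) (I + 1) b = α)
    (h : ((I + 1) * (1 - a) + (K + 1) * a) * B (I + K + 1) I a
      ≤ ((I + 1) * (1 - b) + (K + 1) * b) * B (I + K + 1) (I + 1) b) :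
    (1 - α) * (b - a) ≤ ∫ p in a..b, ∑ x ∈ Finset.Icc (I + 1) (I + K + 1), B (I + K + 1) x p := by
  have hN : (0 : ℝ) < I + K + 2 := by positivity
  have hG : ∀ p : ℝ, HasDerivAt (fun t => t - ((t - (I + 1) / (I + K + 2)) *
      (∑ x ∈ Finset.range (I + 1), B (I + K + 1) x t)
        - (t * (1 - t)) * BDeriv (I + K + 1) (I + 1) t / (I + K + 2)))
      (∑ x ∈ Finset.Icc (I + 1) (I + K + 1), B (I + K + 1) x p) p := by
    intro p
    have hD : HasDerivAt (fun t => t * (1 - t) * BDeriv (I + K + 1) (I + 1) t)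
        (BDeriv (I + K + 1) (I + 1) p * ((I + 1) * (1 - p) - (K + 1) * p)) p := by
      have e : (fun t => t * (1 - t) * BDeriv (I + K + 1) (I + 1) t)
          = fun t => (I + 1) * ((1 - t) * B (I + K + 1) (I + 1) t) := by
        funext t
        have := BDeriv_mul (I + K + 1) (I + 1) t
        push_cast at this
        linear_combination (1 - t) * this
      rw [e]
      refine ((((hasDerivAt_id p).const_sub 1).mul
        (hasDerivAt_B (I + K + 1) (I + 1) p)).const_mul (I + 1 : ℝ)).congr_deriv ?_
      have h1 := BDeriv_mul (I + K + 1) (I + 1) p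
      have h2 := BDeriv_succ_mul (n := I + K + 1) (i := I + 1) (by omega) p
      push_cast at h1 h2
      simp only [id]
      linear_combination (-(I + 1) : ℝ) * h2 + (1 + K : ℝ) * h1
    refine ((hasDerivAt_id p).sub ((((hasDerivAt_id p).sub_const _).mul
      (hasDerivAt_sum_B (I + K + 1) (I + 1) p)).sub (hD.div_const (I + K + 2)))).congr_deriv ?_
    rw [sum_Icc_B (by omega)]
    simp only [id]
    field_simp
    ring
  have hcont : Continuous fun p => ∑ x ∈ Finset.Icc (I + 1) (I + K + 1), B (I + K + 1) x p := by
    unfold B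
    fun_prop
  rw [intervalIntegral.integral_eq_sub_of_hasDerivAt (fun p _ => hG p)
    (hcont.intervalIntegrable _ _)]
  have h1 := BDeriv_succ_mul (n := I + K + 1) (i := I) (by omega) a
  have h2 := BDeriv_mul (I + K + 1) (I + 1) b
  push_cast at h1 h2
  have hFa : ∑ x ∈ Finset.range (I + 1), B (I + K + 1) x a = α + B (I + K + 1) I a / 2 := by
    rw [Finset.sum_range_succ, ← ha, midTail]
    ring
  have hFb : ∑ x ∈ Finset.range (I + 1), B (I + K + 1) x b = α - B (I + K + 1) (I + 1) b / 2 := by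
    rw [← hb, midTail]
    ring
  rw [hFa, hFb, ← sub_nonneg]
  have key : 0 ≤ (((I + 1) * (1 - b) + (K + 1) * b) * B (I + K + 1) (I + 1) b
      - ((I + 1) * (1 - a) + (K + 1) * a) * B (I + K + 1) I a) / (2 * (I + K + 2)) :=
    div_nonneg (sub_nonneg.2 h) (by positivity)
  refine key.trans_eq ?_
  field_simp
  linear_combination (-2 * (1 - b)) * h2 + 2 * a * h1

lemma le_mul_pow_of_le {K : ℕ} (hK : 1 ≤ K) {w W : ℝ} (hW : 5 ≤ W) (hwW : W ≤ w)
    (h : (1 + 2 * (1 - 1 / W) / K) ^ (K + 1) ≤ W) : (1 + 2 * (1 - 1 / w) / K) ^ (K + 1) ≤ w := by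
  have hK' : (1 : ℝ) ≤ K := by exact_mod_cast hK
  have hW0 : 0 < W := by linarith
  have hw0 : 0 < w := by linarith
  have hc : ∀ {v : ℝ}, 5 ≤ v → 0 < 1 - 1 / v := fun {v} hv => by
    rw [sub_pos, div_lt_one (by linarith)]
    linarith
  have hf : ∀ {v : ℝ}, 5 ≤ v → 0 < 1 + 2 * (1 - 1 / v) / K := fun {v} hv => by
    have := hc hv
    positivity
  have hfw := hf (hW.trans hwW)
  have hfW := hf hW
  set F := 1 + 2 * (1 - 1 / W) / K with hF
  set f := 1 + 2 * (1 - 1 / w) / K with hf'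
  have hf1 : 1 ≤ f := by
    have := hc (hW.trans hwW)
    rw [hf', le_add_iff_nonneg_right]
    positivity
  have hdiff : F / f = 1 + -(2 * (w - W) / (w * W * K * f)) := by
    rw [div_eq_iff hfw.ne', add_mul, one_mul, ← sub_eq_iff_eq_add', hF, hf']
    have : (1 + 2 * (1 - 1 / W) / K) - (1 + 2 * (1 - 1 / w) / K) = -(2 * (w - W) / (w * W * K)) := by
      field_simp
      ring
    rw [this, neg_mul, div_mul_eq_mul_div, mul_div_mul_right _ _ hfw.ne']
  have hbern := one_add_mul_le_pow (a := -(2 * (w - W) / (w * W * K * f))) (by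
    have : 0 < F / f := by positivity
    linarith) (K + 1)
  rw [← hdiff, div_pow] at hbern
  have hle : W / w ≤ 1 + ((K + 1 : ℕ) : ℝ) * -(2 * (w - W) / (w * W * K * f)) := by
    have h1 : 2 * (K + 1 : ℝ) ≤ W * K * f := by
      calc 2 * (K + 1 : ℝ) ≤ 5 * K * 1 := by linarith
        _ ≤ W * K * f := by gcongr
    have h2 : W / w = 1 + -((w - W) / w) := by
      field_simp
      ring
    rw [h2, mul_neg, add_le_add_iff_left, neg_le_neg_iff, mul_div_assoc', div_le_div_iff₀
      (by positivity) hw0]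
    push_cast
    have := mul_le_mul_of_nonneg_left h1 (mul_nonneg (sub_nonneg.2 hwW) hw0.le)
    linarith
  have h3 := hle.trans hbern
  rw [div_le_div_iff₀ hw0 (by positivity)] at h3
  have h4 := h3.trans (mul_le_mul_of_nonneg_right h hw0.le)
  exact le_of_mul_le_mul_left h4 hW0

lemma le_of_lt_pow_mul {n : ℕ} (hn : 2 ≤ n) {w W δ : ℝ} (hw : 2 ≤ w)
    (h : δ * (1 + (W - 2) / n) ^ n ≤ W) (hlt : w < δ * (1 + (w - 2) / n) ^ n) : W ≤ w := by
  by_contra! hwW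
  have hn' : (2 : ℝ) ≤ n := by exact_mod_cast hn
  have hpos : ∀ {v : ℝ}, 2 ≤ v → 0 < 1 + (v - 2) / n := fun {v} hv => by
    have : 0 ≤ v - 2 := by linarith
    positivity
  have hfw := hpos hw
  have hfW := hpos (hw.trans hwW.le)
  have hwp : 0 < w := by linarith
  have hbern := one_add_mul_le_pow (a := (W - w) / (n * (1 + (w - 2) / n))) (by
    have : 0 ≤ (W - w) / (n * (1 + (w - 2) / n)) :=
      div_nonneg (by linarith) (by positivity)
    linarith) n
  have hdiff : 1 + (W - w) / (n * (1 + (w - 2) / n)) = (1 + (W - 2) / n) / (1 + (w - 2) / n) := by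
    rw [eq_div_iff hfw.ne', add_mul, div_mul_eq_mul_div, mul_div_mul_right _ _ hfw.ne']
    ring
  have hle : W / w ≤ 1 + n * ((W - w) / (n * (1 + (w - 2) / n))) := by
    have h2 : W / w = 1 + (W - w) / w := by
      field_simp
      ring
    rw [h2, add_le_add_iff_left, mul_div_assoc',
      mul_div_mul_left _ _ (show (n : ℝ) ≠ 0 by positivity)]
    refine div_le_div_of_nonneg_left (by linarith) (by positivity) ?_
    have : (w - 2) / n ≤ w - 2 := div_le_self (by linarith) (by linarith)
    linarith
  rw [hdiff, div_pow] at hbern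
  have h3 := hle.trans hbern
  rw [div_le_div_iff₀ hwp (by positivity)] at h3
  have hδ : 0 < δ := by
    by_contra! hδ
    linarith [mul_nonpos_of_nonpos_of_nonneg hδ (pow_nonneg hfw.le n)]
  have hpw := pow_pos hfw n
  have h4 : (1 + (W - 2) / n) ^ n * w < (1 + (W - 2) / n) ^ n * (δ * (1 + (w - 2) / n) ^ n) :=
    mul_lt_mul_of_pos_left hlt (by positivity)
  have h5 := mul_le_mul_of_nonneg_right h hpw.le
  linarith

namespace ScaledOdds

/-- Five times a lower bound for `2 + n * b / (1 - b)`, where `b` is the second upper endpoint. -/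
def bound (n : ℕ) : ℕ :=
  if n = 2 then 50 else if n = 3 then 40 else if n = 4 then 35 else if n ≤ 10 then 30 else 26

lemma bound_spec : ∀ K < 200, 1 ≤ K →
    26 ≤ bound (K + 1) ∧
    (5 * (K + 1) + (bound (K + 1) - 10)) ^ (K + 1) ≤ bound (K + 1) * (5 * (K + 1)) ^ (K + 1) ∧
    5 * (bound (K + 1) * K + 2 * (bound (K + 1) - 5)) ^ (K + 1)
      ≤ bound (K + 1) * (bound (K + 1) * K) ^ (K + 1) := by
  decide +kernel

lemma exists_bound {K : ℕ} (hK : 1 ≤ K) (hK' : K < 200) :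
    ∃ W : ℝ, 5 ≤ W ∧ 1 / 5 * (1 + (W - 2) / (K + 1 : ℕ)) ^ (K + 1) ≤ W ∧
      (1 + 2 * (1 - 1 / W) / K) ^ (K + 1) ≤ W := by
  obtain ⟨h1, h2, h3⟩ := bound_spec K hK' hK
  set k := bound (K + 1)
  have hk : (26 : ℝ) ≤ k := by exact_mod_cast h1
  have hKp : (1 : ℝ) ≤ K := by exact_mod_cast hK
  have h2' : (5 * (K + 1) + (k - 10) : ℝ) ^ (K + 1) ≤ k * (5 * (K + 1)) ^ (K + 1) := by
    have : ((k - 10 : ℕ) : ℝ) = k - 10 := by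
      rw [Nat.cast_sub (by omega)]
      norm_num
    rw [← this]
    exact_mod_cast h2
  have h3' : 5 * (k * K + 2 * (k - 5) : ℝ) ^ (K + 1) ≤ k * (k * K) ^ (K + 1) := by
    have : ((k - 5 : ℕ) : ℝ) = k - 5 := by
      rw [Nat.cast_sub (by omega)]
      norm_num
    rw [← this]
    exact_mod_cast h3
  refine ⟨k / 5, by linarith, ?_, ?_⟩
  · have : 1 + ((k : ℝ) / 5 - 2) / (K + 1 : ℕ) = (5 * (K + 1) + (k - 10)) / (5 * (K + 1)) := by
      push_cast
      field_simp
      ring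
    rw [this, div_pow]
    have := (div_le_iff₀ (by positivity)).2 h2'
    linarith
  · have : 1 + 2 * (1 - 1 / ((k : ℝ) / 5)) / K = (k * K + 2 * (k - 5)) / (k * K) := by
      field_simp
    rw [this, div_pow, div_le_div_iff₀ (by positivity) (by positivity)]
    linarith

end ScaledOdds

lemma linear_mul_B_zero_le {K : ℕ} (hK : 1 ≤ K) (hn : K < 200) {α a b : ℝ} (hα : α < 1 / 10)
    (ha1 : a < 1) (hb0 : 0 < b) (hb1 : b < 1) (ha : midTail (K + 1) 0 a = α)
    (hb : midTail (K + 1) 1 b = α) :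
    ((1 - a) + (K + 1) * a) * B (K + 1) 0 a ≤ ((1 - b) + (K + 1) * b) * B (K + 1) 1 b := by
  obtain ⟨W, hW5, hW1, hW2⟩ := ScaledOdds.exists_bound hK hn
  simp only [midTail, B, Finset.sum_range_zero, Finset.sum_range_one, Nat.choose_zero_right,
    Nat.choose_one_right, pow_zero, pow_one, Nat.sub_zero, Nat.add_sub_cancel, Nat.cast_one,
    one_mul, mul_one, zero_add] at ha hb ⊢
  obtain ⟨q, rfl⟩ : ∃ q, a = 1 - q := ⟨1 - a, by ring⟩
  obtain ⟨s, rfl⟩ : ∃ s, b = 1 - s := ⟨1 - b, by ring⟩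
  simp only [sub_sub_cancel] at ha hb ⊢
  have hq : 0 < q := by linarith
  have hs : 0 < s := by linarith
  have hKp : (1 : ℝ) ≤ K := by exact_mod_cast hK
  push_cast at ha hb ⊢
  obtain ⟨w, hw⟩ : ∃ w, w * s = 2 * s + (K + 1) * (1 - s) :=
    ⟨(2 * s + (K + 1) * (1 - s)) / s, div_mul_cancel₀ _ hs.ne'⟩
  have hw2 : 2 ≤ w := by
    refine le_of_mul_le_mul_right ?_ hs
    rw [hw, le_add_iff_nonneg_right]
    positivity
  have hqs : q ^ (K + 1) = s ^ (K + 1) * w := by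
    linear_combination 2 * ha - 2 * hb - s ^ K * hw
  have hinv : s * (1 + (w - 2) / (K + 1 : ℕ)) = 1 := by
    push_cast
    field_simp
    linear_combination hw
  have hWw : W ≤ w := by
    refine le_of_lt_pow_mul (by omega) hw2 hW1 ?_
    refine lt_of_mul_lt_mul_left ?_ (pow_pos hs (K + 1)).le
    rw [mul_left_comm, ← mul_pow, hinv, ← hqs, one_pow]
    linarith
  have hle : s * (1 + 2 * (1 - 1 / w) / K) ≤ q := by
    refine le_of_pow_le_pow_left₀ (n := K + 1) (by omega) hq.le ?_
    rw [hqs, mul_pow]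
    exact mul_le_mul_of_nonneg_left (le_mul_pow_of_le hK hW5 hWw hW2) (by positivity)
  have hwp : 0 < w := by linarith
  have hle' : s * (w * (K + 2) - 2) ≤ K * q * w := by
    have := mul_le_mul_of_nonneg_left hle (show 0 ≤ K * w by positivity)
    have e : K * w * (s * (1 + 2 * (1 - 1 / w) / K)) = s * (w * (K + 2) - 2) := by
      field_simp
      ring
    linarith
  have hsK := pow_pos hs K
  rw [hqs]
  have := mul_le_mul_of_nonneg_left hle' (mul_nonneg hsK.le hs.le)
  linear_combination this + (s ^ K * (K + 1) - s ^ K * s * (K + 2)) * hw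

lemma integral_pow_ge {n : ℕ} {a : ℝ} (ha0 : 0 ≤ a) (ha1 : a ≤ 1) :
    (1 - a) * (a ^ n + n * a ^ (n - 1) * (1 - a) / 2) ≤ ∫ p in a..1, p ^ n := by
  have h : ∀ p ∈ Set.Icc a 1, a ^ n + n * a ^ (n - 1) * (p - a) ≤ p ^ n := by
    intro p hp
    cases n with
    | zero => simp
    | succ n =>
      rcases ha0.eq_or_lt with rfl | ha
      · rcases n.eq_zero_or_pos with rfl | hn
        · simp
        · have : 0 ≤ p ^ (n + 1) := pow_nonneg hp.1 _
          simpa [zero_pow hn.ne'] using this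
      · have := one_add_mul_le_pow (a := p / a - 1) (by
          have : 0 ≤ p / a := div_nonneg (by linarith [hp.1]) ha0
          linarith) (n + 1)
        rw [add_sub_cancel, div_pow, le_div_iff₀ (by positivity)] at this
        refine le_of_eq_of_le ?_ this
        rw [Nat.add_sub_cancel]
        field_simp
        ring
  have h1 : ∫ p in a..1, (a ^ n + n * a ^ (n - 1) * (p - a))
      = (1 - a) * (a ^ n + n * a ^ (n - 1) * (1 - a) / 2) := by
    have hd : ∀ p ∈ Set.uIcc a 1, HasDerivAt
        (fun t => a ^ n * t + n * a ^ (n - 1) * ((t - a) ^ 2 / 2))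
        (a ^ n + n * a ^ (n - 1) * (p - a)) p := fun p _ => by
      refine (((hasDerivAt_id p).const_mul (a ^ n)).add
        (((((hasDerivAt_id p).sub_const a).pow 2).div_const 2).const_mul
          (n * a ^ (n - 1)))).congr_deriv ?_
      simp
    rw [intervalIntegral.integral_eq_sub_of_hasDerivAt hd
      (Continuous.intervalIntegrable (by fun_prop) _ _)]
    ring
  rw [← h1]
  exact intervalIntegral.integral_mono_on ha1 (Continuous.intervalIntegrable (by fun_prop) _ _)
    (Continuous.intervalIntegrable (by fun_prop) _ _) h

lemma integral_sum_B_ge_of_eq_one {m : ℕ} {α a : ℝ} (ha0 : 0 ≤ a) (ha1 : a ≤ 1)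
    (ha : midTail (m + 1) m a = α) :
    (1 - α) * (1 - a) ≤ ∫ p in a..1, ∑ x ∈ Finset.Icc (m + 1) (m + 1), B (m + 1) x p := by
  have h1 := sum_Icc_B (n := m + 1) (i := m + 1) (by omega) a
  rw [Finset.sum_range_succ] at h1
  have h2 : ∀ p, ∑ x ∈ Finset.Icc (m + 1) (m + 1), B (m + 1) x p = p ^ (m + 1) := fun p => by
    simp [B]
  have h3 : B (m + 1) m a = (m + 1) * a ^ m * (1 - a) := by
    simp [B]
  rw [h2, h3] at h1
  rw [midTail, h3] at ha
  simp only [h2]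
  refine le_of_eq_of_le ?_ (integral_pow_ge ha0 ha1)
  rw [Nat.add_sub_cancel]
  push_cast
  linear_combination (1 - a) * (ha - h1)

lemma IsMidPUpper.isLCCUpper {n : ℕ} (hn1 : 1 ≤ n) (hn2 : n ≤ 200) {α : ℝ} (hα0 : 0 < α)
    (hα : α < 1 / 10) {u : ℕ → ℝ} (hu : IsMidPUpper n α u) : IsLCCUpper n α u := by
  obtain ⟨hun, hu⟩ := hu
  have hmid : ∀ i < n, midTail n i (u i) = α := fun i hi => (hu i hi).2.2
  refine ⟨(hu 0 (by omega)).1, fun i hi => ?_, hun, fun i hi1 hin => ?_⟩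
  · obtain ⟨h1, h2, -⟩ := hu i hi
    rcases (Nat.succ_le_of_lt hi).eq_or_lt with h | h
    · rw [show i + 1 = n from h, hun]
      exact h2
    · obtain ⟨h3, h4, -⟩ := hu (i + 1) h
      exact lt_of_midTail_eq hi h1 h2 h3.le h4.le ((hmid i hi).trans (hmid (i + 1) h).symm)
  · obtain ⟨I, rfl⟩ := Nat.exists_eq_add_of_le' hi1
    obtain ⟨h1, h2, -⟩ := hu I hin
    rw [Nat.add_sub_cancel]
    rcases hin.eq_or_lt with rfl | h
    · rw [hun]
      exact integral_sum_B_ge_of_eq_one h1.le h2.le (hmid I hin)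
    · obtain ⟨K, rfl⟩ : ∃ K, n = I + K + 1 := ⟨n - (I + 1), by omega⟩
      obtain ⟨h3, h4, -⟩ := hu (I + 1) h
      refine integral_sum_B_ge I K (hmid I hin) (hmid (I + 1) h) ?_
      rcases I.eq_zero_or_pos with rfl | hI
      · have := linear_mul_B_zero_le (K := K) (by omega) (by omega) hα h2 h3 h4
          (by simpa using hmid 0 hin) (by simpa using hmid 1 h)
        simpa using this
      · exact linear_mul_B_le hI (by omega) hn2 hα0 hα h1 h2 h3 h4 (hmid I hin) (hmid (I + 1) h)

lemma B_one_sub {n x : ℕ} (hx : x ≤ n) (p : ℝ) : B n x (1 - p) = B n (n - x) p := by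
  rw [B, B, Nat.choose_symm hx, Nat.sub_sub_self hx, sub_sub_cancel]
  ring

lemma sum_Icc_B_one_sub {n i : ℕ} (p : ℝ) (hi : i ≤ n) :
    ∑ x ∈ Finset.Icc (n - i) n, B n x (1 - p) = ∑ x ∈ Finset.range (i + 1), B n x p := by
  refine Finset.sum_bij' (fun x _ => n - x) (fun x _ => n - x) ?_ ?_ ?_ ?_ ?_
  · intro x hx
    simp only [Finset.mem_Icc, Finset.mem_range] at *
    omega
  · intro x hx
    simp only [Finset.mem_Icc, Finset.mem_range] at *
    omega
  · intro x hx
    simp only [Finset.mem_Icc] at *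
    omega
  · intro x hx
    simp only [Finset.mem_range] at *
    omega
  · intro x hx
    exact B_one_sub (Finset.mem_Icc.1 hx).2 p

lemma sum_range_B_one_sub {n i : ℕ} (p : ℝ) (hi : i ≤ n) :
    ∑ x ∈ Finset.range (n - i), B n x (1 - p) = ∑ x ∈ Finset.Icc (i + 1) n, B n x p := by
  have h1 := sum_Icc_B (n := n) (i := n - i) (by omega) (1 - p)
  have h2 := sum_Icc_B (n := n) (i := i + 1) (by omega) p
  rw [sum_Icc_B_one_sub p hi] at h1
  linarith

lemma IsMidPLower.isMidPUpper {n : ℕ} {α : ℝ} {l : ℕ → ℝ} (hl : IsMidPLower n α l) :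
    IsMidPUpper n α (fun i => 1 - l (n - i)) := by
  obtain ⟨h0, hl⟩ := hl
  refine ⟨by simp [h0], fun i hi => ?_⟩
  obtain ⟨h1, h2, h3⟩ := hl (n - i) (by omega) (by omega)
  refine ⟨by linarith, by linarith, ?_⟩
  have h4 := sum_range_B_one_sub (n := n) (i := n - i) (l (n - i)) (by omega)
  rw [Nat.sub_sub_self hi.le] at h4
  rw [h4, B_one_sub hi.le, h3]

lemma isLCCLower_of_isLCCUpper {n : ℕ} {α : ℝ} {l : ℕ → ℝ}
    (h : IsLCCUpper n α (fun i => 1 - l (n - i))) : IsLCCLower n α l := by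
  obtain ⟨h1, h2, h3, h4⟩ := h
  simp only [Nat.sub_zero, Nat.sub_self] at h1 h2 h3
  refine ⟨by linarith, fun i hi => ?_, by linarith, fun i hi => ?_⟩
  · have := h2 (n - (i + 1)) (by omega)
    rw [Nat.sub_sub_self hi, show n - (n - (i + 1) + 1) = i by omega] at this
    linarith
  · have := h4 (n - i) (by omega) (by omega)
    simp only [Nat.sub_sub_self hi.le, show n - (n - i - 1) = i + 1 by omega] at this
    rw [← intervalIntegral.integral_comp_sub_left
      (fun p => ∑ x ∈ Finset.Icc (n - i) n, B n x p) 1] at this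
    simp only [sum_Icc_B_one_sub _ hi.le] at this
    linarith

theorem stmt_6 (n : ℕ) (hn1 : 1 ≤ n) (hn2 : n ≤ 200)
    (α : ℝ) (hα1 : (0.0001 : ℝ) < α) (hα2 : α < 0.1)
    (u l : ℕ → ℝ) (hu : IsMidPUpper n α u) (hl : IsMidPLower n α l) :
    IsLCCUpper n α u ∧ IsLCCLower n α l := by
  have hα0 : 0 < α := by linarith
  have hα : α < 1 / 10 := by linarith
  exact ⟨hu.isLCCUpper hn1 hn2 hα0 hα,
    isLCCLower_of_isLCCUpper (hl.isMidPUpper.isLCCUpper hn1 hn2 hα0 hα)⟩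
end

section
/- Let n ≥ 1 be an integer, let α satisfy 0 < α < 1/2, and let u_0,…,u_n be the mid-p upper endpoints at level 1−α. Then for every i = 1,…,n the coverage crosses the nominal level between consecutive spikes: Σ_{x=i}^n B(n,x,u_{i−1}) < 1−α, while Σ_{x=i}^n B(n,x,u_i) > 1−α. In particular, on each interval (u_{i−1}, u_i] the coverage C_u(p) = Σ_{x=i}^n B(n,x,p) takes values both below and above 1−α. -/
open MeasureTheory

theorem sum_B_range_succ (n : ℕ) (p : ℝ) : ∑ x ∈ Finset.range (n + 1), B n x p = 1 := by
  have h := add_pow p (1 - p) n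
  rw [add_sub_cancel, one_pow] at h
  rw [h]
  exact Finset.sum_congr rfl fun x _ => by unfold B; ring

theorem sum_B_range_add_sum_B_Icc {n i : ℕ} (hi : i ≤ n) (p : ℝ) :
    ∑ x ∈ Finset.range i, B n x p + ∑ x ∈ Finset.Icc i n, B n x p = 1 := by
  rw [← sum_B_range_succ n p, ← Finset.Ico_add_one_right_eq_Icc]
  exact Finset.sum_range_add_sum_Ico _ (Nat.le_succ_of_le hi)

theorem B_pos {n x : ℕ} (hx : x ≤ n) {p : ℝ} (hp0 : 0 < p) (hp1 : p < 1) : 0 < B n x p := by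
  have hchoose : (0 : ℝ) < n.choose x := by exact_mod_cast Nat.choose_pos hx
  have hq : 0 < 1 - p := sub_pos.mpr hp1
  unfold B
  positivity

theorem stmt_11 (n : ℕ) (hn : 1 ≤ n)
    (α : ℝ) (hα1 : 0 < α) (hα2 : α < 1 / 2)
    (u : ℕ → ℝ) (hu : IsMidPUpper n α u) :
    ∀ i, 1 ≤ i → i ≤ n →
      (∑ x ∈ Finset.Icc i n, B n x (u (i - 1))) < 1 - α ∧
        1 - α < ∑ x ∈ Finset.Icc i n, B n x (u i) := by
  intro i hi hin
  obtain ⟨hun, hu⟩ := hu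
  constructor
  · obtain ⟨j, rfl⟩ := Nat.exists_eq_add_of_le' hi
    rw [Nat.add_sub_cancel]
    obtain ⟨h0, h1, hα⟩ := hu j hin
    have hsum := sum_B_range_add_sum_B_Icc hin (u j)
    rw [Finset.sum_range_succ] at hsum
    have hpos := B_pos (Nat.le_of_succ_le hin) h0 h1
    linarith
  · rcases hin.lt_or_eq with hlt | rfl
    · obtain ⟨h0, h1, hα⟩ := hu i hlt
      have hsum := sum_B_range_add_sum_B_Icc hin (u i)
      have hpos := B_pos hin h0 h1
      linarith
    · simpa [hun, B] using hα1
end
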